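/- arXiv:1309.1899 — 2 statements merged into one kernel-verified Lean document; each statement's English description precedes it below -/
import Mathlib

section
/- The divisors D_{copl} and D_{V-ap} are different. Precisely, the Zariski closure (in the 56-dimensional space of cubic forms in 6 variables) of the set C₁ = {f : f = Σᵢ₌₁¹⁰ (aᵢ·x)³ for some a₁,…,a₁₀ ∈ ℂ⁶ with dim span{a₁,a₂,a₃,a₄} ≤ 3} is not equal to the Zariski closure of the set C₂ = {f : f is apolar to some Veronese surface, i.e., ∃ A ∈ GL₆(ℂ) with ⟨f,k⟩ = 0 for every cubic form k vanishing identically on A·ν(ℂ³)}. (Proposition \ref{newprop19aout} of the paper.) -/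
open MvPolynomial

/-- The constant-coefficient differential operator associated with the monomial
exponent `d`: the composition over `i` of `(∂/∂xᵢ)^(d i)`. -/
noncomputable def monOp {n : ℕ} (d : Fin n →₀ ℕ) :
    Module.End ℂ (MvPolynomial (Fin n) ℂ) :=
  (List.ofFn fun i : Fin n =>
    ((pderiv (R := ℂ) i).toLinearMap : Module.End ℂ (MvPolynomial (Fin n) ℂ)) ^ (d i)).prod

/-- The apolarity action `g ∘ f` : apply `g`, viewed as a constant-coefficient
differential operator, to `f`. -/
noncomputable def apolar {n : ℕ} (g f : MvPolynomial (Fin n) ℂ) :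
    MvPolynomial (Fin n) ℂ :=
  ∑ d ∈ g.support, coeff d g • monOp d f

/-- The apolarity pairing `⟨f, k⟩ := k ∘ f` (its constant term). -/
noncomputable def pairing {n : ℕ} (f k : MvPolynomial (Fin n) ℂ) : ℂ :=
  eval (fun _ => (0 : ℂ)) (apolar k f)

/-- The linear form `Σ vᵢ xᵢ` associated with a vector `v`. -/
noncomputable def linForm {n : ℕ} (v : Fin n → ℂ) : MvPolynomial (Fin n) ℂ :=
  ∑ i, MvPolynomial.C (v i) * X i

/-- The directional partial derivative `∂_v f = Σ vᵢ ∂f/∂xᵢ`. -/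
noncomputable def pdir {n : ℕ} (v : Fin n → ℂ) (f : MvPolynomial (Fin n) ℂ) :
    MvPolynomial (Fin n) ℂ :=
  ∑ i, MvPolynomial.C (v i) * pderiv i f

/-- The Veronese map `ν : ℂ³ → ℂ⁶`. -/
noncomputable def nu (w : Fin 3 → ℂ) : Fin 6 → ℂ :=
  ![w 0 ^ 2, 2 * w 0 * w 1, 2 * w 0 * w 2, w 1 ^ 2, 2 * w 1 * w 2, w 2 ^ 2]

/-- The components of the Veronese map as quadratic forms in `y₀, y₁, y₂`. -/
noncomputable def nuPoly : Fin 6 → MvPolynomial (Fin 3) ℂ :=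
  ![X 0 ^ 2, 2 * X 0 * X 1, 2 * X 0 * X 2, X 1 ^ 2, 2 * X 1 * X 2, X 2 ^ 2]

/-- A quadratic form `q` in 6 variables has rank `≤ r`: there is a symmetric matrix
`M` of rank `≤ r` with `q(x) = xᵀ M x`. -/
def QuadRankLe (q : MvPolynomial (Fin 6) ℂ) (r : ℕ) : Prop :=
  ∃ M : Matrix (Fin 6) (Fin 6) ℂ, M.IsSymm ∧ M.rank ≤ r ∧
    ∀ x : Fin 6 → ℂ, eval x q = ∑ i, ∑ j, M i j * x i * x j

/-- `s` is the linear map carrying a ternary sextic `g` to the cubic `s(g)` in six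
variables, characterized by `⟨s(g), k⟩ = ⟨g, m(k)⟩` for all cubic forms `k`, where
`m(k) = k ∘ ν`. -/
def IsSMap (s : MvPolynomial (Fin 3) ℂ →ₗ[ℂ] MvPolynomial (Fin 6) ℂ) : Prop :=
  (∀ g : MvPolynomial (Fin 3) ℂ, g.IsHomogeneous 6 → (s g).IsHomogeneous 3) ∧
  ∀ g : MvPolynomial (Fin 3) ℂ, ∀ k : MvPolynomial (Fin 6) ℂ,
    g.IsHomogeneous 6 → k.IsHomogeneous 3 →
      pairing (s g) k = pairing g (aeval nuPoly k)

/-- Evaluation of a polynomial function `P` in the coefficients at a polynomial `g`. -/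
noncomputable def evalCoeff {σ : Type} (g : MvPolynomial σ ℂ) (P : MvPolynomial (σ →₀ ℕ) ℂ) : ℂ :=
  eval (fun d => coeff d g) P

/-- The vanishing ideal of a subset of `ℂ⁵⁶`. -/
noncomputable def vanishingIdealOf (S : Set (Fin 56 → ℂ)) : Ideal (MvPolynomial (Fin 56) ℂ) :=
  ⨅ x ∈ S, RingHom.ker (eval x)

/-- An ideal is a prime ideal of height one: it is prime, admits a prime strictly
below it, and admits no chain of two primes strictly below it. -/
def IsHeightOnePrime {R : Type*} [CommRing R] (I : Ideal R) : Prop :=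
  I.IsPrime ∧ (∃ p : Ideal R, p.IsPrime ∧ p < I) ∧
    ∀ p q : Ideal R, p.IsPrime → q.IsPrime → p < q → ¬ q < I

/-- The space `Q_{f,U}` of quadratic forms vanishing on `U` and apolar to `f`. -/
def QfU (f : MvPolynomial (Fin 6) ℂ) (U : Submodule ℂ (Fin 6 → ℂ)) :
    Set (MvPolynomial (Fin 6) ℂ) :=
  {q | q.IsHomogeneous 2 ∧ (∀ u ∈ U, eval u q = 0) ∧ apolar q f = 0}

/-- The Zariski closure of a subset of `ℂ⁵⁶`. -/
def zcl (S : Set (Fin 56 → ℂ)) : Set (Fin 56 → ℂ) :=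
  {x | ∀ P : MvPolynomial (Fin 56) ℂ, (∀ y ∈ S, eval y P = 0) → eval x P = 0}

/-- The projection of a polynomial onto its squarefree monomials. -/
noncomputable def sqfreeProj (f : MvPolynomial (Fin 6) ℂ) : MvPolynomial (Fin 6) ℂ :=
  ∑ d ∈ f.support.filter (fun d => ∀ i, d i ≤ 1), monomial d (coeff d f)

open Filter Topology

/-! ### Polynomial functions along curves -/

theorem MvPolynomial.hasDerivAt_eval_comp {σ : Type*} [Fintype σ] (P : MvPolynomial σ ℂ)
    {γ : ℂ → σ → ℂ} {γ' : σ → ℂ} {t : ℂ} (hγ : ∀ i, HasDerivAt (fun s => γ s i) (γ' i) t) :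
    HasDerivAt (fun s => eval (γ s) P) (∑ i, eval (γ t) (pderiv i P) * γ' i) t := by
  classical
  induction P using MvPolynomial.induction_on with
  | C a => simpa using hasDerivAt_const t a
  | add p q hp hq =>
    simp only [map_add, add_mul, Finset.sum_add_distrib]
    exact hp.add hq
  | mul_X p i hp =>
    have h := hp.mul (hγ i)
    simp only [map_mul, eval_X]
    refine h.congr_deriv (Eq.symm ?_)
    simp only [Derivation.leibniz, pderiv_X, smul_eq_mul, map_add, map_mul, eval_X, add_mul,
      Finset.sum_add_distrib, Finset.sum_mul]
    rw [add_comm]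
    congr 1
    · refine Finset.sum_congr rfl fun j _ => by ring
    · rw [Finset.sum_eq_single i]
      · simp
      · intro j _ hj
        simp [Pi.single_eq_of_ne hj.symm]
      · simp

theorem MvPolynomial.differentiable_eval_comp {σ : Type*} [Fintype σ] (P : MvPolynomial σ ℂ)
    {γ : ℂ → σ → ℂ} (hγ : Differentiable ℂ γ) : Differentiable ℂ fun s => eval (γ s) P :=
  fun t => (P.hasDerivAt_eval_comp (t := t) fun i =>
    ((differentiable_pi.1 hγ i) t).hasDerivAt).differentiableAt

/-- If `P` vanishes along a curve, its differential kills the velocity vector. -/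
theorem MvPolynomial.sum_pderiv_mul_eq_zero {σ : Type*} [Fintype σ] (P : MvPolynomial σ ℂ)
    {γ : ℂ → σ → ℂ} {γ' : σ → ℂ} (hP : ∀ t, eval (γ t) P = 0)
    (hγ : ∀ i, HasDerivAt (fun s => γ s i) (γ' i) 0) :
    ∑ i, eval (γ 0) (pderiv i P) * γ' i = 0 := by
  have h := P.hasDerivAt_eval_comp hγ
  simp only [hP] at h
  exact h.unique (hasDerivAt_const _ _)

theorem Differentiable.eventually_ne_zero {g : ℂ → ℂ} (hg : Differentiable ℂ g) {a : ℂ}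
    (ha : g a ≠ 0) (z : ℂ) : ∀ᶠ t in 𝓝[≠] z, g t ≠ 0 := by
  have han : AnalyticOnNhd ℂ g Set.univ := fun z _ => hg.analyticAt z
  rcases (han z trivial).eventually_eq_zero_or_eventually_ne_zero with h | h
  · exact absurd (han.eqOn_zero_of_preconnected_of_eventuallyEq_zero isPreconnected_univ
      trivial h (Set.mem_univ a)) ha
  · exact h

theorem Differentiable.eq_zero_of_eventually {g : ℂ → ℂ} (hg : Differentiable ℂ g) {z : ℂ}
    (h : ∀ᶠ t in 𝓝 z, g t = 0) (a : ℂ) : g a = 0 :=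
  AnalyticOnNhd.eqOn_zero_of_preconnected_of_eventuallyEq_zero
    (fun z _ => hg.analyticAt z) isPreconnected_univ (Set.mem_univ z) h (Set.mem_univ a)

/-- A closed homogeneous condition with only the trivial solution at `x₀` has only the trivial
solution near `x₀`. -/
theorem eventually_forall_eq_zero_of_isClosed {X E : Type*} [TopologicalSpace X]
    [NormedAddCommGroup E] [NormedSpace ℂ E] [FiniteDimensional ℂ E] {F : X → E → Prop}
    (hF : IsClosed {p : X × E | F p.1 p.2}) (hsmul : ∀ x k (c : ℂ), F x k → F x (c • k))
    {x₀ : X} (h₀ : ∀ k, F x₀ k → k = 0) : ∀ᶠ x in 𝓝 x₀, ∀ k, F x k → k = 0 := by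
  have : ProperSpace E := FiniteDimensional.proper ℂ E
  have hcl : IsClosed {x : X | ∃ k ∈ Metric.sphere (0 : E) 1, F x k} := by
    have : CompactSpace (Metric.sphere (0 : E) 1) :=
      isCompact_iff_compactSpace.1 (isCompact_sphere 0 1)
    have hc : IsClosed {p : X × Metric.sphere (0 : E) 1 | F p.1 p.2} :=
      hF.preimage (f := fun p : X × Metric.sphere (0 : E) 1 => (p.1, (p.2 : E))) (by fun_prop)
    convert isClosedMap_fst_of_compactSpace _ hc using 1
    ext x
    simp
  have hx : x₀ ∉ {x : X | ∃ k ∈ Metric.sphere (0 : E) 1, F x k} := by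
    rintro ⟨k, hk, hFk⟩
    rw [h₀ k hFk] at hk
    simp at hk
  filter_upwards [hcl.isOpen_compl.mem_nhds hx] with x hx k hk
  by_contra hne
  refine hx ⟨((‖k‖⁻¹ : ℝ) : ℂ) • k, ?_, hsmul _ _ _ hk⟩
  simp [norm_smul, hne]

/-- Polynomials outnumbering their variables satisfy an algebraic relation. -/
theorem MvPolynomial.exists_relation_of_card_lt {σ ι : Type} [Fintype σ] [Fintype ι]
    (h : Fintype.card σ < Fintype.card ι) (p : ι → MvPolynomial σ ℂ) :
    ∃ P : MvPolynomial ι ℂ, P ≠ 0 ∧ ∀ y : σ → ℂ, eval (fun n => eval y (p n)) P = 0 := by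
  have hdep : ¬ AlgebraicIndependent ℂ p := by
    intro hp
    have := hp.cardinalMk_le_trdeg
    rw [MvPolynomial.trdeg_of_isDomain] at this
    simp at this
    omega
  rw [algebraicIndependent_iff] at hdep
  push Not at hdep
  obtain ⟨P, hP, hne⟩ := hdep
  refine ⟨P, hne, fun y => ?_⟩
  have h := congrArg (eval y) hP
  rw [map_zero, aeval_def, eval₂_eq', map_sum] at h
  rw [← h, eval_eq']
  refine Finset.sum_congr rfl fun d _ => ?_
  simp

/-- A nonzero polynomial of minimal degree vanishing on a set has somewhere on the set a
nonzero partial derivative. -/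
theorem MvPolynomial.exists_vanishing_pderiv_ne_zero {ι : Type*} [Fintype ι] {S : Set (ι → ℂ)}
    (hS : S.Nonempty) (h : ∃ P : MvPolynomial ι ℂ, P ≠ 0 ∧ ∀ y ∈ S, eval y P = 0) :
    ∃ P : MvPolynomial ι ℂ, (∀ y ∈ S, eval y P = 0) ∧
      ∃ y ∈ S, ∃ n, eval y (pderiv n P) ≠ 0 := by
  classical
  let D : Set ℕ := {d | ∃ P : MvPolynomial ι ℂ, P ≠ 0 ∧ (∀ y ∈ S, eval y P = 0) ∧
    P.totalDegree = d}
  have hD : D.Nonempty := by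
    obtain ⟨P, hP, hv⟩ := h
    exact ⟨_, P, hP, hv, rfl⟩
  obtain ⟨P, hP, hv, hd⟩ := Nat.sInf_mem hD
  refine ⟨P, hv, ?_⟩
  by_contra hcon
  push Not at hcon
  have hzero : ∀ n, pderiv n P = 0 := by
    intro n
    by_contra hne
    have hle : P.totalDegree ≤ (pderiv n P).totalDegree := by
      rw [hd]
      exact Nat.sInf_le ⟨_, hne, fun y hy => hcon y hy n, rfl⟩
    have hne' : (pderiv n P).support.Nonempty := support_nonempty.2 hne
    obtain ⟨m, hm, hmd⟩ := Finset.exists_mem_eq_sup _ hne' fun s => s.sum fun _ e => e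
    rw [mem_support_iff, coeff_pderiv] at hm
    have hmem : m + Finsupp.single n 1 ∈ P.support := mem_support_iff.2 (left_ne_zero_of_mul hm)
    have hlt := le_totalDegree hmem
    rw [Finsupp.sum_add_index' (by simp) (by simp), Finsupp.sum_single_index rfl] at hlt
    change (pderiv n P).totalDegree = _ at hmd
    omega
  have hconst : P = C (coeff 0 P) := by
    ext d
    rw [coeff_C]
    split_ifs with hd0
    · rw [hd0]
    · obtain ⟨n, hn⟩ := Finsupp.ne_iff.1 (Ne.symm hd0)
      have hc := congrArg (coeff (d - Finsupp.single n 1)) (hzero n)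
      have hle : Finsupp.single n 1 ≤ d :=
        Finsupp.single_le_iff.2 (Nat.one_le_iff_ne_zero.2 hn)
      rw [coeff_pderiv, tsub_add_cancel_of_le hle, coeff_zero] at hc
      exact (mul_eq_zero.1 hc).resolve_right (Nat.cast_add_one_ne_zero _)
  obtain ⟨y, hy⟩ := hS
  have h0 := hv y hy
  rw [hconst, eval_C] at h0
  exact hP (by rw [hconst, h0, C_0])

/-! ### Trilinear forms on a six-dimensional space -/

section Trilinear

variable {R : Type*} [CommRing R]

/-- The trilinear form with coefficient tensor `k`. -/
def tri (k : Fin 6 → Fin 6 → Fin 6 → R) (u v w : Fin 6 → R) : R :=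
  ∑ i, ∑ j, ∑ l, k i j l * (u i * v j * w l)

/-- Total symmetry of a tensor with three indices. -/
def IsSymTensor (k : Fin 6 → Fin 6 → Fin 6 → R) : Prop :=
  ∀ i j l, k i j l = k j i l ∧ k i j l = k i l j

/-- The matrix of the quadratic polar of the cubic form `tri k x x x`. -/
def polarMatrix (k : Fin 6 → Fin 6 → Fin 6 → R) (x : Fin 6 → R) : Matrix (Fin 6) (Fin 6) R :=
  Matrix.of fun i j => ∑ l, k i j l * x l

/-- This expression vanishes for all `x`, `y` if and only if the Hessian of the cubic form
`tri k x x x` is proportional to its square. -/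
def hessianDefect (k : Fin 6 → Fin 6 → Fin 6 → R) (x y : Fin 6 → R) : R :=
  (polarMatrix k x).det * tri k y y y ^ 2 - (polarMatrix k y).det * tri k x x x ^ 2

theorem tri_add_left (k : Fin 6 → Fin 6 → Fin 6 → R) (u u' v w : Fin 6 → R) :
    tri k (u + u') v w = tri k u v w + tri k u' v w := by
  simp only [tri, Pi.add_apply, add_mul, mul_add, Finset.sum_add_distrib]

theorem tri_smul_left (k : Fin 6 → Fin 6 → Fin 6 → R) (c : R) (u v w : Fin 6 → R) :
    tri k (c • u) v w = c * tri k u v w := by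
  simp only [tri, Pi.smul_apply, smul_eq_mul, Finset.mul_sum]
  exact Finset.sum_congr rfl fun i _ => Finset.sum_congr rfl fun j _ =>
    Finset.sum_congr rfl fun l _ => by ring

theorem IsSymTensor.tri_swap_left {k : Fin 6 → Fin 6 → Fin 6 → R} (hk : IsSymTensor k)
    (u v w : Fin 6 → R) : tri k u v w = tri k v u w := by
  unfold tri
  rw [Finset.sum_comm]
  exact Finset.sum_congr rfl fun i _ => Finset.sum_congr rfl fun j _ =>
    Finset.sum_congr rfl fun l _ => by rw [(hk j i l).1]; ring

theorem IsSymTensor.tri_swap_right {k : Fin 6 → Fin 6 → Fin 6 → R} (hk : IsSymTensor k)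
    (u v w : Fin 6 → R) : tri k u v w = tri k u w v := by
  unfold tri
  refine Finset.sum_congr rfl fun i _ => ?_
  rw [Finset.sum_comm]
  exact Finset.sum_congr rfl fun j _ => Finset.sum_congr rfl fun l _ => by
    rw [(hk i l j).2]; ring

theorem IsSymTensor.tri_line {k : Fin 6 → Fin 6 → Fin 6 → R} (hk : IsSymTensor k)
    (a d : Fin 6 → R) (t : R) :
    tri k (a + t • d) (a + t • d) (a + t • d) =
      tri k a a a + 3 * t * tri k a a d + 3 * t ^ 2 * tri k a d d + t ^ 3 * tri k d d d := by
  have h2 : ∀ u v v' w : Fin 6 → R, tri k u (v + v') w = tri k u v w + tri k u v' w := by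
    intro u v v' w
    rw [hk.tri_swap_left, tri_add_left, hk.tri_swap_left v, hk.tri_swap_left v']
  have h3 : ∀ u v w w' : Fin 6 → R, tri k u v (w + w') = tri k u v w + tri k u v w' := by
    intro u v w w'
    rw [hk.tri_swap_right, h2, hk.tri_swap_right u w, hk.tri_swap_right u w']
  have s2 : ∀ (c : R) (u v w : Fin 6 → R), tri k u (c • v) w = c * tri k u v w := by
    intro c u v w
    rw [hk.tri_swap_left, tri_smul_left, hk.tri_swap_left v]
  have s3 : ∀ (c : R) (u v w : Fin 6 → R), tri k u v (c • w) = c * tri k u v w := by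
    intro c u v w
    rw [hk.tri_swap_right, s2, hk.tri_swap_right u w]
  simp only [tri_add_left, h2, h3, tri_smul_left, s2, s3]
  rw [hk.tri_swap_right a d a, hk.tri_swap_left d a a, hk.tri_swap_right a d a,
    hk.tri_swap_left d a d, hk.tri_swap_right d d a, hk.tri_swap_left d a d]
  ring

theorem map_tri {S : Type*} [CommRing S] (f : R →+* S) (k : Fin 6 → Fin 6 → Fin 6 → R)
    (u v w : Fin 6 → R) :
    f (tri k u v w) = tri (fun i j l => f (k i j l)) (fun i => f (u i)) (fun i => f (v i))
      (fun i => f (w i)) := by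
  simp [tri]

theorem map_hessianDefect {S : Type*} [CommRing S] (f : R →+* S)
    (k : Fin 6 → Fin 6 → Fin 6 → R) (x y : Fin 6 → R) :
    f (hessianDefect k x y) =
      hessianDefect (fun i j l => f (k i j l)) (fun i => f (x i)) (fun i => f (y i)) := by
  have h : ∀ x : Fin 6 → R, f (polarMatrix k x).det =
      (polarMatrix (fun i j l => f (k i j l)) fun i => f (x i)).det := by
    intro x
    rw [RingHom.map_det]
    congr 1
    ext i j
    simp [polarMatrix]
  simp only [hessianDefect, map_sub, map_mul, map_pow, map_tri, h]

/-- The tensor of a trilinear form after the linear substitution `A`. -/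
def pullback (A : Matrix (Fin 6) (Fin 6) R) (k : Fin 6 → Fin 6 → Fin 6 → R) :
    Fin 6 → Fin 6 → Fin 6 → R :=
  fun i j l => tri k (A.col i) (A.col j) (A.col l)

theorem tri_sum_smul_left {ι : Type*} (t : Finset ι) (k : Fin 6 → Fin 6 → Fin 6 → R) (c : ι → R)
    (u : ι → Fin 6 → R) (v w : Fin 6 → R) :
    tri k (∑ i ∈ t, c i • u i) v w = ∑ i ∈ t, c i * tri k (u i) v w := by
  classical
  induction t using Finset.induction_on with
  | empty => simp [tri]
  | insert a t ha ih => rw [Finset.sum_insert ha, Finset.sum_insert ha, tri_add_left,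
      tri_smul_left, ih]

theorem tri_pullback (A : Matrix (Fin 6) (Fin 6) R) {k : Fin 6 → Fin 6 → Fin 6 → R}
    (hk : IsSymTensor k) (u v w : Fin 6 → R) :
    tri (pullback A k) u v w = tri k (A.mulVec u) (A.mulVec v) (A.mulVec w) := by
  have hA : ∀ u : Fin 6 → R, A.mulVec u = ∑ i, u i • A.col i := by
    intro u
    ext r
    simp [Matrix.mulVec, dotProduct, mul_comm]
  rw [hA u, tri_sum_smul_left]
  simp only [tri, pullback]
  refine Finset.sum_congr rfl fun i _ => ?_
  change _ = u i * tri k (A.col i) _ _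
  rw [hk.tri_swap_left, hA v, tri_sum_smul_left, Finset.mul_sum]
  refine Finset.sum_congr rfl fun j _ => ?_
  rw [hk.tri_swap_left, hk.tri_swap_right, hk.tri_swap_left, hA w, tri_sum_smul_left,
    Finset.mul_sum, Finset.mul_sum]
  refine Finset.sum_congr rfl fun l _ => ?_
  rw [hk.tri_swap_left, hk.tri_swap_right]
  simp only [tri]
  ring

theorem IsSymTensor.pullback {k : Fin 6 → Fin 6 → Fin 6 → R} (hk : IsSymTensor k)
    (A : Matrix (Fin 6) (Fin 6) R) : IsSymTensor (pullback A k) :=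
  fun _ _ _ => ⟨hk.tri_swap_left _ _ _, hk.tri_swap_right _ _ _⟩

theorem polarMatrix_pullback (A : Matrix (Fin 6) (Fin 6) R) {k : Fin 6 → Fin 6 → Fin 6 → R}
    (hk : IsSymTensor k) (x : Fin 6 → R) :
    polarMatrix (pullback A k) x = A.transpose * polarMatrix k (A.mulVec x) * A := by
  have h : ∀ (k : Fin 6 → Fin 6 → Fin 6 → R) (x u v : Fin 6 → R),
      tri k u v x = u ⬝ᵥ (polarMatrix k x).mulVec v := by
    intro k x u v
    simp only [tri, polarMatrix, dotProduct, Matrix.mulVec, Matrix.of_apply, Finset.mul_sum,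
      Finset.sum_mul]
    exact Finset.sum_congr rfl fun i _ => Finset.sum_congr rfl fun j _ =>
      Finset.sum_congr rfl fun l _ => by ring
  ext i j
  have e := tri_pullback A hk (Pi.single i 1) (Pi.single j 1) x
  rw [h, h] at e
  rw [Matrix.mul_assoc]
  simpa [Matrix.mul_apply, Matrix.mulVec, dotProduct, Finset.mul_sum, Finset.sum_mul,
    Pi.single_apply] using e

theorem hessianDefect_pullback (A : Matrix (Fin 6) (Fin 6) R) {k : Fin 6 → Fin 6 → Fin 6 → R}
    (hk : IsSymTensor k) (x y : Fin 6 → R) :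
    hessianDefect (pullback A k) x y =
      A.det ^ 2 * hessianDefect k (A.mulVec x) (A.mulVec y) := by
  simp only [hessianDefect, polarMatrix_pullback A hk, tri_pullback A hk, Matrix.det_mul,
    Matrix.det_transpose]
  ring

end Trilinear

/-! ### Points of secant varieties and their conormal tensors -/

section Secant

variable {ι : Type*} [Fintype ι]

/-- The image of the cube of a vector under the linear map given by the tensor `s`. -/
def cubePt (s : Fin 6 → Fin 6 → Fin 6 → ι → ℂ) (v : Fin 6 → ℂ) : ι → ℂ :=
  fun n => tri (fun i j l => s i j l n) v v v

/-- A linear combination of cubes. -/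
def secantPt {κ : Type*} [Fintype κ] (s : Fin 6 → Fin 6 → Fin 6 → ι → ℂ) (c : κ → ℂ)
    (a : κ → Fin 6 → ℂ) : ι → ℂ :=
  ∑ r, c r • cubePt s (a r)

/-- The differential of `P` at `y`, pulled back to a tensor. -/
noncomputable def gradTensor (s : Fin 6 → Fin 6 → Fin 6 → ι → ℂ) (P : MvPolynomial ι ℂ)
    (y : ι → ℂ) : Fin 6 → Fin 6 → Fin 6 → ℂ :=
  fun i j l => ∑ n, eval y (pderiv n P) * s i j l n

variable {s : Fin 6 → Fin 6 → Fin 6 → ι → ℂ}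

theorem isSymTensor_gradTensor (hs : IsSymTensor s) (P : MvPolynomial ι ℂ) (y : ι → ℂ) :
    IsSymTensor (gradTensor s P y) := by
  intro i j l
  simp only [gradTensor]
  rw [← (hs i j l).1, ← (hs i j l).2]
  exact ⟨rfl, rfl⟩

theorem tri_gradTensor (s : Fin 6 → Fin 6 → Fin 6 → ι → ℂ) (P : MvPolynomial ι ℂ) (y : ι → ℂ)
    (u v w : Fin 6 → ℂ) :
    tri (gradTensor s P y) u v w =
      ∑ n, eval y (pderiv n P) * tri (fun i j l => s i j l n) u v w := by
  simp only [tri, gradTensor, Finset.mul_sum, Finset.sum_mul]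
  refine Eq.symm (Finset.sum_comm.trans (Finset.sum_congr rfl fun i _ => Finset.sum_comm.trans
    (Finset.sum_congr rfl fun j _ => Finset.sum_comm.trans (Finset.sum_congr rfl fun l _ =>
      Finset.sum_congr rfl fun n _ => by ring))))

theorem hasDerivAt_cubePt (hs : IsSymTensor s) (a d : Fin 6 → ℂ) (n : ι) :
    HasDerivAt (fun t : ℂ => cubePt s (a + t • d) n) (3 * tri (fun i j l => s i j l n) a a d) 0 := by
  have hsn : IsSymTensor fun i j l => s i j l n := fun i j l =>
    ⟨congrFun (hs i j l).1 n, congrFun (hs i j l).2 n⟩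
  simp only [cubePt, hsn.tri_line]
  set p := tri (fun i j l => s i j l n) a a a
  set q := tri (fun i j l => s i j l n) a a d
  set r := tri (fun i j l => s i j l n) a d d
  set w := tri (fun i j l => s i j l n) d d d
  have h1 := ((hasDerivAt_id (0 : ℂ)).const_mul 3).mul_const q
  have h2 := (((hasDerivAt_id (0 : ℂ)).pow 2).const_mul 3).mul_const r
  have h3 := ((hasDerivAt_id (0 : ℂ)).pow 3).mul_const w
  refine (((h1.const_add p).add h2).add h3).congr_deriv ?_
  simp

variable {κ : Type*} [Fintype κ]

/-- Tangent vectors obtained by moving the points of a sum of cubes are killed by the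
differential of a polynomial vanishing along the motion. -/
theorem sum_tri_gradTensor_eq_zero (hs : IsSymTensor s) (P : MvPolynomial ι ℂ) (c : κ → ℂ)
    (a d : κ → Fin 6 → ℂ) (hP : ∀ t : ℂ, eval (secantPt s c (a + t • d)) P = 0) :
    ∑ r, c r * tri (gradTensor s P (secantPt s c a)) (a r) (a r) (d r) = 0 := by
  have h := P.sum_pderiv_mul_eq_zero hP
    (γ' := fun n => ∑ r, c r * (3 * tri (fun i j l => s i j l n) (a r) (a r) (d r))) (by
      intro n
      simp only [secantPt, Finset.sum_apply, Pi.smul_apply, Pi.add_apply, smul_eq_mul]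
      refine HasDerivAt.fun_sum fun r _ => ?_
      exact (hasDerivAt_cubePt hs (a r) (d r) n).const_mul _)
  simp only [zero_smul, add_zero] at h
  simp only [tri_gradTensor, Finset.mul_sum] at h ⊢
  rw [Finset.sum_comm] at h
  have h3 : (3 : ℂ) * ∑ r, ∑ n, c r * (eval (secantPt s c a) (pderiv n P) *
      tri (fun i j l => s i j l n) (a r) (a r) (d r)) = 0 := by
    rw [← h]
    simp only [Finset.mul_sum]
    exact Finset.sum_congr rfl fun r _ => Finset.sum_congr rfl fun n _ => by ring
  exact (mul_eq_zero.1 h3).resolve_left (by norm_num)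

theorem tri_gradTensor_self_eq_zero (P : MvPolynomial ι ℂ) (y : ι → ℂ) (v : Fin 6 → ℂ)
    (hP : ∀ t : ℂ, eval (y + t • cubePt s v) P = 0) : tri (gradTensor s P y) v v v = 0 := by
  have h := P.sum_pderiv_mul_eq_zero hP (γ' := cubePt s v) (by
    intro n
    simp only [Pi.add_apply, Pi.smul_apply, smul_eq_mul]
    simpa using ((hasDerivAt_id (0 : ℂ)).mul_const (cubePt s v n)).const_add (y n))
  simpa [tri_gradTensor, cubePt] using h

/-- The polynomial whose values are the Hessian defects of the conormal tensors. -/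
noncomputable def defectPoly (s : Fin 6 → Fin 6 → Fin 6 → ι → ℂ) (P : MvPolynomial ι ℂ)
    (x y : Fin 6 → ℂ) : MvPolynomial ι ℂ :=
  hessianDefect (fun i j l => ∑ n, pderiv n P * C (s i j l n)) (fun i => C (x i)) fun i => C (y i)

theorem eval_defectPoly (P : MvPolynomial ι ℂ) (x y : Fin 6 → ℂ) (z : ι → ℂ) :
    eval z (defectPoly s P x y) = hessianDefect (gradTensor s P z) x y := by
  simp only [defectPoly, map_hessianDefect, map_sum, map_mul, eval_C]
  rfl

/-- If the tensors `s i j l` span, a vanishing conormal tensor means a vanishing differential. -/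
theorem pderiv_eq_zero_of_gradTensor_eq_zero
    (hspan : ∀ g : ι → ℂ, (∀ i j l, ∑ n, g n * s i j l n = 0) → g = 0) {P : MvPolynomial ι ℂ}
    {y : ι → ℂ} (h : gradTensor s P y = 0) (n : ι) : eval y (pderiv n P) = 0 :=
  congrFun (hspan (fun n => eval y (pderiv n P)) fun i j l =>
    congrFun (congrFun (congrFun h i) j) l) n

@[fun_prop]
theorem Differentiable.tri_comp {k : Fin 6 → Fin 6 → Fin 6 → ℂ} {u v w : ℂ → Fin 6 → ℂ}
    (hu : Differentiable ℂ u) (hv : Differentiable ℂ v) (hw : Differentiable ℂ w) :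
    Differentiable ℂ fun t => tri k (u t) (v t) (w t) := by
  unfold tri
  fun_prop

theorem differentiable_secantPt {c : ℂ → κ → ℂ} {a : ℂ → κ → Fin 6 → ℂ}
    (hc : Differentiable ℂ c) (ha : Differentiable ℂ a) :
    Differentiable ℂ fun t => secantPt s (c t) (a t) := by
  rw [differentiable_pi]
  intro n
  simp only [secantPt, cubePt, Finset.sum_apply, Pi.smul_apply, smul_eq_mul]
  fun_prop

theorem differentiable_gradTensor (P : MvPolynomial ι ℂ) {γ : ℂ → ι → ℂ}
    (hγ : Differentiable ℂ γ) (i j l : Fin 6) :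
    Differentiable ℂ fun t => gradTensor s P (γ t) i j l := by
  have h := fun n => (pderiv n P).differentiable_eval_comp hγ
  unfold gradTensor
  fun_prop

end Secant

/-! ### The conormal tensor at a special coplanar sum of cubes -/

/-- Three vectors spanning the plane used for the special coplanar sum of cubes. -/
def specialPlane : Fin 3 → Fin 6 → ℂ :=
  ![![1, -1, 1, 0, 1, 0], ![1, 0, -1, 1, -1, 0], ![-1, 1, -1, -1, 1, 1]]

/-- The sum of the three vectors of `specialPlane`. -/
def specialFourth : Fin 6 → ℂ := ![1, 0, -1, 0, 1, 1]

set_option maxHeartbeats 1000000 in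
theorem tri_squarefree {k : Fin 6 → Fin 6 → Fin 6 → ℂ} (hk : IsSymTensor k)
    (hd : ∀ i j, k i i j = 0) (u w : Fin 6 → ℂ) :
    tri k u u w = 2 * (
    k 0 1 2 * (u 0 * u 1 * w 2 + u 0 * u 2 * w 1 + u 1 * u 2 * w 0) +
    k 0 1 3 * (u 0 * u 1 * w 3 + u 0 * u 3 * w 1 + u 1 * u 3 * w 0) +
    k 0 1 4 * (u 0 * u 1 * w 4 + u 0 * u 4 * w 1 + u 1 * u 4 * w 0) +
    k 0 1 5 * (u 0 * u 1 * w 5 + u 0 * u 5 * w 1 + u 1 * u 5 * w 0) +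
    k 0 2 3 * (u 0 * u 2 * w 3 + u 0 * u 3 * w 2 + u 2 * u 3 * w 0) +
    k 0 2 4 * (u 0 * u 2 * w 4 + u 0 * u 4 * w 2 + u 2 * u 4 * w 0) +
    k 0 2 5 * (u 0 * u 2 * w 5 + u 0 * u 5 * w 2 + u 2 * u 5 * w 0) +
    k 0 3 4 * (u 0 * u 3 * w 4 + u 0 * u 4 * w 3 + u 3 * u 4 * w 0) +
    k 0 3 5 * (u 0 * u 3 * w 5 + u 0 * u 5 * w 3 + u 3 * u 5 * w 0) +
    k 0 4 5 * (u 0 * u 4 * w 5 + u 0 * u 5 * w 4 + u 4 * u 5 * w 0) +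
    k 1 2 3 * (u 1 * u 2 * w 3 + u 1 * u 3 * w 2 + u 2 * u 3 * w 1) +
    k 1 2 4 * (u 1 * u 2 * w 4 + u 1 * u 4 * w 2 + u 2 * u 4 * w 1) +
    k 1 2 5 * (u 1 * u 2 * w 5 + u 1 * u 5 * w 2 + u 2 * u 5 * w 1) +
    k 1 3 4 * (u 1 * u 3 * w 4 + u 1 * u 4 * w 3 + u 3 * u 4 * w 1) +
    k 1 3 5 * (u 1 * u 3 * w 5 + u 1 * u 5 * w 3 + u 3 * u 5 * w 1) +
    k 1 4 5 * (u 1 * u 4 * w 5 + u 1 * u 5 * w 4 + u 4 * u 5 * w 1) +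
    k 2 3 4 * (u 2 * u 3 * w 4 + u 2 * u 4 * w 3 + u 3 * u 4 * w 2) +
    k 2 3 5 * (u 2 * u 3 * w 5 + u 2 * u 5 * w 3 + u 3 * u 5 * w 2) +
    k 2 4 5 * (u 2 * u 4 * w 5 + u 2 * u 5 * w 4 + u 4 * u 5 * w 2) +
    k 3 4 5 * (u 3 * u 4 * w 5 + u 3 * u 5 * w 4 + u 4 * u 5 * w 3)) := by
  have h₁ : ∀ i j l, k i j l = k j i l := fun i j l => (hk i j l).1
  have h₂ : ∀ i j l, k i j l = k i l j := fun i j l => (hk i j l).2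
  have d₂ : ∀ i j, k i j i = 0 := fun i j => by rw [h₂, hd]
  have d₃ : ∀ i j, k j i i = 0 := fun i j => by rw [h₁, d₂]
  simp only [tri, Fin.sum_univ_six, hd, d₂, d₃, zero_mul, add_zero, zero_add]
  have s₁ : ∀ i j l, j < i → k i j l = k j i l := fun i j l _ => h₁ i j l
  have s₂ : ∀ i j l, l < j → k i j l = k i l j := fun i j l _ => h₂ i j l
  simp (disch := decide) only [s₁, s₂]
  ring

set_option maxHeartbeats 1000000 in
/-- The conormal tensors at the special coplanar sum of cubes form a line. -/
theorem special_tensor_eq {k : Fin 6 → Fin 6 → Fin 6 → ℂ} (hk : IsSymTensor k)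
    (hd : ∀ i j, k i i j = 0)
    (h₂ : ∀ j, tri k (specialPlane j) (specialPlane j) (specialPlane j) = 0)
    (h₃ : ∀ j y, tri k (specialPlane j) (specialPlane j) (Pi.single y 1) +
      tri k specialFourth specialFourth (Pi.single y 1) = 0) :
    k 0 1 2 = 0 ∧ k 0 1 3 = 0 ∧ k 0 1 4 = 0 ∧ k 0 1 5 = k 0 2 4 ∧
    k 0 2 3 = 0 ∧ k 0 2 5 = 0 ∧ k 0 3 4 = 0 ∧ k 0 3 5 = -k 0 2 4 ∧
    k 0 4 5 = 0 ∧ k 1 2 3 = k 0 2 4 ∧ k 1 2 4 = k 0 2 4 ∧ k 1 2 5 = 0 ∧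
    k 1 3 4 = -k 0 2 4 ∧ k 1 3 5 = -2 * k 0 2 4 ∧ k 1 4 5 = -k 0 2 4 ∧ k 2 3 4 = -k 0 2 4 ∧
    k 2 3 5 = -k 0 2 4 ∧ k 2 4 5 = -k 0 2 4 ∧ k 3 4 5 = 0 := by
  simp only [tri_squarefree hk hd, specialFourth, specialPlane] at h₂ h₃
  have e0 : -k 0 1 2 - k 0 1 4 + k 0 2 4 - k 1 2 4 = 0 := by
    have h := h₂ 0
    simp at h
    linear_combination h / 3
  have e1 : -k 0 2 3 + k 0 2 4 - k 0 3 4 + k 2 3 4 = 0 := by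
    have h := h₂ 1
    simp at h
    linear_combination h / 3
  have e2 : -k 0 1 2 - k 0 1 4 - k 0 2 5 + k 0 4 5 = 0 := by
    have h := h₃ 0 0
    simp at h
    linear_combination h / 2
  have e3 : 2 * k 0 1 4 + k 0 1 5 - k 1 2 5 + k 1 4 5 = 0 := by
    have h := h₃ 0 1
    simp at h
    linear_combination h / 2
  have e4 : -k 0 1 4 + k 0 4 5 - k 1 2 4 - k 2 4 5 = 0 := by
    have h := h₃ 0 4
    simp at h
    linear_combination h / 2
  have e5 : -k 0 1 5 + 2 * k 0 4 5 - k 1 2 5 - k 1 4 5 = 0 := by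
    have h := h₃ 0 5
    simp at h
    linear_combination h / 2
  have e6 : -k 0 2 3 - k 0 2 5 - k 0 3 4 + k 0 4 5 = 0 := by
    have h := h₃ 1 0
    simp at h
    linear_combination h / 2
  have e7 : k 0 2 3 + k 0 2 5 - k 2 3 4 + k 2 4 5 = 0 := by
    have h := h₃ 1 2
    simp at h
    linear_combination h / 2
  have e8 : -2 * k 0 2 3 + k 0 3 5 - k 2 3 5 + k 3 4 5 = 0 := by
    have h := h₃ 1 3
    simp at h
    linear_combination h / 2
  have e9 : -2 * k 0 2 5 + k 0 3 5 - k 2 3 5 - k 3 4 5 = 0 := by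
    have h := h₃ 1 5
    simp at h
    linear_combination h / 2
  have e10 : -k 0 1 2 + 2 * k 0 2 4 + k 0 2 5 - k 1 2 4 + k 2 4 5 = 0 := by
    have h := h₃ 0 2
    simp at h
    linear_combination h / 2
  have e11 : -2 * k 0 2 4 + k 0 3 4 + k 0 4 5 - k 2 3 4 - k 2 4 5 = 0 := by
    have h := h₃ 1 4
    simp at h
    linear_combination h / 2
  have e12 : -k 0 1 3 + 2 * k 0 3 4 + k 0 3 5 - k 1 2 3 - k 1 3 4 - k 2 3 5 + k 3 4 5 = 0 := by
    have h := h₃ 0 3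
    simp at h
    linear_combination h / 2
  have e13 : -2 * k 0 1 2 + k 0 1 3 + k 0 1 5 - k 1 2 3 - k 1 2 5 - k 1 3 4 + k 1 4 5 = 0 := by
    have h := h₃ 1 1
    simp at h
    linear_combination h / 2
  have e14 : k 0 1 3 + k 1 2 3 - 2 * k 1 2 4 - 2 * k 1 2 5 - k 1 3 4 - k 1 3 5 + 2 * k 1 4 5 = 0 := by
    have h := h₃ 2 1
    simp at h
    linear_combination h / 2
  have e15 : -k 0 1 3 - k 1 2 3 + k 1 3 4 + k 1 3 5 - 2 * k 2 3 4 - 2 * k 2 3 5 + 2 * k 3 4 5 = 0 := by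
    have h := h₃ 2 3
    simp at h
    linear_combination h / 2
  have e16 : -k 0 1 2 + k 0 2 3 - k 1 2 3 + k 1 2 4 + k 1 2 5 - k 2 3 4 - k 2 3 5 + 2 * k 2 4 5 = 0 := by
    have h := h₃ 2 2
    simp at h
    linear_combination h / 2
  have e17 : -k 0 1 5 + k 0 3 5 - k 1 2 5 - k 1 3 5 + k 1 4 5 + k 2 3 5 - 2 * k 2 4 5 - k 3 4 5 = 0 := by
    have h := h₃ 2 5
    simp at h
    linear_combination h / 2
  have e18 : -k 0 1 2 - k 0 1 3 + k 0 1 4 + k 0 1 5 + k 0 2 3 - 2 * k 0 2 4 - 2 * k 0 2 5 - k 0 3 4 - k 0 3 5 + 2 * k 0 4 5 = 0 := by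
    have h := h₃ 2 0
    simp at h
    linear_combination h / 2
  refine ⟨?_, ?_, ?_, ?_, ?_, ?_, ?_, ?_, ?_, ?_, ?_, ?_, ?_, ?_, ?_, ?_, ?_, ?_, ?_⟩ <;> grind

theorem IsSymTensor.eq_zero_of_sorted {k : Fin 6 → Fin 6 → Fin 6 → ℂ} (hk : IsSymTensor k)
    (h : ∀ i j l, i ≤ j → j ≤ l → k i j l = 0) : k = 0 := by
  have h₁ : ∀ i j l, k i j l = k j i l := fun i j l => (hk i j l).1
  have h₂ : ∀ i j l, k i j l = k i l j := fun i j l => (hk i j l).2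
  ext i j l
  change k i j l = 0
  rcases le_total i j with hij | hij <;> rcases le_total j l with hjl | hjl <;>
    rcases le_total i l with hil | hil <;> grind

set_option linter.unusedSimpArgs false in
set_option maxHeartbeats 1000000 in
theorem eq_zero_of_special {k : Fin 6 → Fin 6 → Fin 6 → ℂ} (hk : IsSymTensor k)
    (hd : ∀ i j, k i i j = 0)
    (h₂ : ∀ j, tri k (specialPlane j) (specialPlane j) (specialPlane j) = 0)
    (h₃ : ∀ j y, tri k (specialPlane j) (specialPlane j) (Pi.single y 1) +
      tri k specialFourth specialFourth (Pi.single y 1) = 0)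
    (hdef : ∀ x y, hessianDefect k x y = 0) : k = 0 := by
  obtain ⟨h012, h013, h014, h015, h023, h025, h034, h035, h045, h123, h124, h125, h134, h135, h145,
    h234, h235, h245, h345⟩ := special_tensor_eq hk hd h₂ h₃
  have h₁ : ∀ i j l, k i j l = k j i l := fun i j l => (hk i j l).1
  have h₂ : ∀ i j l, k i j l = k i l j := fun i j l => (hk i j l).2
  have d₂ : ∀ i j, k i j i = 0 := fun i j => by rw [h₂, hd]
  have d₃ : ∀ i j, k j i i = 0 := fun i j => by rw [h₁, d₂]
  have hp : k 0 2 4 = 0 := by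
    have hx := hdef ![1, 0, 0, 0, 1, 1] ![0, 1, 1, 1, 0, 0]
    let H : Matrix (Fin 6) (Fin 6) ℂ := !![0, 1, 1, -1, 0, 0; 1, 0, 1, -3, -1, 0;
      1, 1, 0, -2, 0, -1; -1, -3, -2, 0, 0, -1; 0, -1, 0, 0, 0, 0; 0, 0, -1, -1, 0, 0]
    have hM : polarMatrix k ![1, 0, 0, 0, 1, 1] = k 0 2 4 • H := by
      ext i j
      fin_cases i <;> fin_cases j <;>
        simp [polarMatrix, Fin.sum_univ_six, hd, d₂, d₃, H] <;> grind
    have hdet : H.det ≠ 0 := by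
      have : H.det = -4 := by
        simp [H, Matrix.det_succ_row_zero, Fin.sum_univ_succ, Fin.succAbove]
        norm_num
      rw [this]
      norm_num
    rw [hessianDefect, tri_squarefree hk hd, tri_squarefree hk hd, hM, Matrix.det_smul, h012, h013,
      h014, h015, h045, h023, h123, h145] at hx
    simp [hdet] at hx
    norm_num at hx
    exact hx
  refine hk.eq_zero_of_sorted fun i j l hij hjl => ?_
  rcases hij.eq_or_lt with rfl | hij
  · exact hd _ _
  rcases hjl.eq_or_lt with rfl | hjl
  · exact d₃ _ _
  clear h₁ h₂ hk hdef h₃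
  fin_cases i <;> fin_cases j <;> first
    | exact absurd hij (by decide)
    | (fin_cases l <;> first
        | exact absurd hjl (by decide)
        | simp only [Fin.reduceFinMk, Fin.zero_eta, Fin.mk_one, Fin.isValue, h012, h013, h014,
            h015, h023, h025, h034, h035, h045, h123, h124, h125, h134, h135, h145, h234, h235,
            h245, h345, hp, neg_zero, mul_zero])

/-! ### Sums of ten cubes of which four are coplanar -/

section Coplanar

variable {ι : Type*} [Fintype ι] {s : Fin 6 → Fin 6 → Fin 6 → ι → ℂ}

/-- Ten vectors, the first four of which are combinations of three vectors `B j`. -/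
def coplanarVectors (B : Fin 3 → Fin 6 → ℂ) (c : Fin 4 → Fin 3 → ℂ) (l : Fin 6 → Fin 6 → ℂ) :
    Fin 4 ⊕ Fin 6 → Fin 6 → ℂ :=
  Sum.elim (fun i => ∑ j, c i j • B j) l

/-- The sum of the cubes of `coplanarVectors B c l`. -/
def coplanarPt (s : Fin 6 → Fin 6 → Fin 6 → ι → ℂ) (B : Fin 3 → Fin 6 → ℂ)
    (c : Fin 4 → Fin 3 → ℂ) (l : Fin 6 → Fin 6 → ℂ) : ι → ℂ :=
  secantPt s (fun _ => 1) (coplanarVectors B c l)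

/-- The tensor `k` kills the tangent directions of the coplanar family, and its Hessian defect
vanishes. -/
def IsCoplanarConormal (B : Fin 3 → Fin 6 → ℂ) (c : Fin 4 → Fin 3 → ℂ) (l : Fin 6 → Fin 6 → ℂ)
    (k : Fin 6 → Fin 6 → Fin 6 → ℂ) : Prop :=
  IsSymTensor k ∧ (∀ i y, tri k (l i) (l i) y = 0) ∧
    (∀ i j, tri k (∑ j, c i j • B j) (∑ j, c i j • B j) (B j) = 0) ∧
    (∀ j y, ∑ i, c i j * tri k (∑ j, c i j • B j) (∑ j, c i j • B j) y = 0) ∧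
    ∀ x y, hessianDefect k x y = 0

theorem isCoplanarConormal_gradTensor (hs : IsSymTensor s) {P : MvPolynomial ι ℂ}
    (hP : ∀ B c l, eval (coplanarPt s B c l) P = 0)
    (hdef : ∀ B c l x y, hessianDefect (gradTensor s P (coplanarPt s B c l)) x y = 0)
    (B : Fin 3 → Fin 6 → ℂ) (c : Fin 4 → Fin 3 → ℂ) (l : Fin 6 → Fin 6 → ℂ) :
    IsCoplanarConormal B c l (gradTensor s P (coplanarPt s B c l)) := by
  refine ⟨isSymTensor_gradTensor hs _ _, fun i y => ?_, fun i j => ?_, fun j y => ?_,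
    hdef B c l⟩
  · have h := sum_tri_gradTensor_eq_zero hs P (fun _ => 1) (coplanarVectors B c l)
      (Sum.elim 0 (Pi.single i y)) (by
        intro t
        refine Eq.trans ?_ (hP B c (l + t • (Pi.single i y : Fin 6 → Fin 6 → ℂ)))
        refine congrArg (fun a => eval (secantPt s (fun _ => 1) a) P) (funext fun r => ?_)
        rcases r with r | r <;> simp [coplanarVectors, Pi.single_apply])
    rw [Fintype.sum_sum_type, Finset.sum_eq_zero (fun r _ => by simp [tri]), zero_add,
      Finset.sum_eq_single i (fun r _ hr => by simp [tri, hr]) (by simp)] at h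
    simpa [coplanarVectors, coplanarPt] using h
  · have h := sum_tri_gradTensor_eq_zero hs P (fun _ => 1) (coplanarVectors B c l)
      (Sum.elim (Pi.single i (B j)) 0) (by
        intro t
        refine Eq.trans ?_ (hP B (c + t • (Pi.single i (Pi.single j 1) : Fin 4 → Fin 3 → ℂ)) l)
        refine congrArg (fun a => eval (secantPt s (fun _ => 1) a) P) (funext fun r => ?_)
        rcases r with r | r
        · rcases eq_or_ne r i with rfl | hr
          · simp [coplanarVectors, add_smul, Finset.sum_add_distrib, Pi.single_apply]
          · simp [coplanarVectors, hr]
        · simp [coplanarVectors])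
    rw [Fintype.sum_sum_type, add_comm, Finset.sum_eq_zero (fun r _ => by simp [tri]), zero_add,
      Finset.sum_eq_single i (fun r _ hr => by simp [tri, hr]) (by simp)] at h
    simpa [coplanarVectors, coplanarPt] using h
  · have h := sum_tri_gradTensor_eq_zero hs P (fun _ => 1) (coplanarVectors B c l)
      (Sum.elim (fun i => c i j • y) 0) (by
        intro t
        refine Eq.trans ?_ (hP (B + t • (Pi.single j y : Fin 3 → Fin 6 → ℂ)) c l)
        refine congrArg (fun a => eval (secantPt s (fun _ => 1) a) P) (funext fun r => ?_)
        rcases r with r | r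
        · ext m
          simp [coplanarVectors, Finset.sum_add_distrib, Pi.single_apply, mul_left_comm]
        · simp [coplanarVectors])
    rw [Fintype.sum_sum_type, add_comm, Finset.sum_eq_zero (fun r _ => by simp [tri]), zero_add]
      at h
    refine (Finset.sum_congr rfl fun i _ => ?_).trans h
    have hg := isSymTensor_gradTensor hs P (coplanarPt s B c l)
    rw [hg.tri_swap_right, hg.tri_swap_left, ← tri_smul_left, hg.tri_swap_left, hg.tri_swap_right,
      one_mul]
    rfl

theorem IsCoplanarConormal.eq_zero_of_special {k : Fin 6 → Fin 6 → Fin 6 → ℂ}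
    (h : IsCoplanarConormal specialPlane
      ![Pi.single 0 1, Pi.single 1 1, Pi.single 2 1, 1] (fun i => Pi.single i 1) k) : k = 0 := by
  obtain ⟨hk, h₁, h₂, h₃, hdef⟩ := h
  have hf : ∑ j, specialPlane j = specialFourth := by
    ext i
    fin_cases i <;> simp [specialPlane, specialFourth, Fin.sum_univ_three]
  refine _root_.eq_zero_of_special hk (fun i j => ?_) (fun j => ?_) (fun j y => ?_) hdef
  · simpa [tri, Pi.single_apply] using h₁ i (Pi.single j 1)
  · fin_cases j
    · simpa [Fin.sum_univ_three, Pi.single_apply] using h₂ 0 0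
    · simpa [Fin.sum_univ_three, Pi.single_apply] using h₂ 1 1
    · simpa [Fin.sum_univ_three, Pi.single_apply] using h₂ 2 2
  · have h := h₃ j (Pi.single y 1)
    rw [← hf]
    fin_cases j <;>
    simpa [Fin.sum_univ_three, Fin.sum_univ_four, Pi.single_apply] using h

theorem isClosed_isCoplanarConormal : IsClosed {p : ((Fin 3 → Fin 6 → ℂ) × (Fin 4 → Fin 3 → ℂ) ×
    (Fin 6 → Fin 6 → ℂ)) × (Fin 6 → Fin 6 → Fin 6 → ℂ) |
    IsCoplanarConormal p.1.1 p.1.2.1 p.1.2.2 p.2} := by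
  simp only [IsCoplanarConormal, IsSymTensor, Set.ofPred_and, Set.ofPred_forall]
  refine IsClosed.inter ?_ (IsClosed.inter ?_ (IsClosed.inter ?_ (IsClosed.inter ?_ ?_)))
  · exact isClosed_iInter fun i => isClosed_iInter fun j => isClosed_iInter fun l =>
      (isClosed_eq (by fun_prop) (by fun_prop)).inter (isClosed_eq (by fun_prop) (by fun_prop))
  · unfold tri
    exact isClosed_iInter fun i => isClosed_iInter fun j => isClosed_eq (by fun_prop) (by fun_prop)
  · unfold tri
    exact isClosed_iInter fun i => isClosed_iInter fun j => isClosed_eq (by fun_prop) (by fun_prop)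
  · unfold tri
    exact isClosed_iInter fun i => isClosed_iInter fun j => isClosed_eq (by fun_prop) (by fun_prop)
  · have hM : ∀ x, Continuous fun k : Fin 6 → Fin 6 → Fin 6 → ℂ => (polarMatrix k x).det :=
      fun x => Continuous.matrix_det (continuous_matrix fun i j => by
        simp only [polarMatrix, Matrix.of_apply]
        fun_prop)
    have hT : ∀ x, Continuous fun k : Fin 6 → Fin 6 → Fin 6 → ℂ => tri k x x x := fun x => by
      unfold tri
      fun_prop
    exact isClosed_iInter fun x => isClosed_iInter fun y => isClosed_eq
      ((((hM x).mul ((hT y).pow 2)).sub ((hM y).mul ((hT x).pow 2))).comp continuous_snd)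
      continuous_const

theorem tri_smul_tensor (k : Fin 6 → Fin 6 → Fin 6 → ℂ) (a : ℂ) (u v w : Fin 6 → ℂ) :
    tri (a • k) u v w = a * tri k u v w := by
  simp only [tri, Pi.smul_apply, smul_eq_mul, Finset.mul_sum, mul_assoc]

theorem hessianDefect_smul_tensor (k : Fin 6 → Fin 6 → Fin 6 → ℂ) (a : ℂ) (x y : Fin 6 → ℂ) :
    hessianDefect (a • k) x y = a ^ 8 * hessianDefect k x y := by
  have h : ∀ x, polarMatrix (a • k) x = a • polarMatrix k x := fun x => by
    ext i j
    simp [polarMatrix, Finset.mul_sum, mul_assoc]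
  simp only [hessianDefect, h, tri_smul_tensor, Matrix.det_smul, Fintype.card_fin]
  ring

theorem IsSymTensor.smul {k : Fin 6 → Fin 6 → Fin 6 → ℂ} (hk : IsSymTensor k) (a : ℂ) :
    IsSymTensor (a • k) := fun i j l => by
  simp only [Pi.smul_apply]
  rw [← (hk i j l).1, ← (hk i j l).2]
  exact ⟨rfl, rfl⟩

/-- If all conormal tensors of the coplanar family have vanishing Hessian defect, they vanish. -/
theorem gradTensor_coplanarPt_eq_zero (hs : IsSymTensor s) {P : MvPolynomial ι ℂ}
    (hP : ∀ B c l, eval (coplanarPt s B c l) P = 0)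
    (hdef : ∀ B c l x y, hessianDefect (gradTensor s P (coplanarPt s B c l)) x y = 0)
    (B : Fin 3 → Fin 6 → ℂ) (c : Fin 4 → Fin 3 → ℂ) (l : Fin 6 → Fin 6 → ℂ) :
    gradTensor s P (coplanarPt s B c l) = 0 := by
  let c₀ : Fin 4 → Fin 3 → ℂ := ![Pi.single 0 1, Pi.single 1 1, Pi.single 2 1, 1]
  let l₀ : Fin 6 → Fin 6 → ℂ := fun i => Pi.single i 1
  have hsmul : ∀ (θ : (Fin 3 → Fin 6 → ℂ) × (Fin 4 → Fin 3 → ℂ) × (Fin 6 → Fin 6 → ℂ))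
      (k : Fin 6 → Fin 6 → Fin 6 → ℂ) (a : ℂ), IsCoplanarConormal θ.1 θ.2.1 θ.2.2 k →
      IsCoplanarConormal θ.1 θ.2.1 θ.2.2 (a • k) := by
    rintro ⟨B, c, l⟩ k a ⟨hk, h₁, h₂, h₃, h₄⟩
    refine ⟨hk.smul a, fun i y => ?_, fun i j => ?_, fun j y => ?_, fun x y => ?_⟩
    · rw [tri_smul_tensor, h₁, mul_zero]
    · rw [tri_smul_tensor, h₂, mul_zero]
    · simp only [tri_smul_tensor, mul_left_comm _ a, ← Finset.mul_sum, h₃, mul_zero]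
    · rw [hessianDefect_smul_tensor, h₄, mul_zero]
  have hev := eventually_forall_eq_zero_of_isClosed
    (F := fun (θ : (Fin 3 → Fin 6 → ℂ) × (Fin 4 → Fin 3 → ℂ) × (Fin 6 → Fin 6 → ℂ)) k =>
      IsCoplanarConormal θ.1 θ.2.1 θ.2.2 k) isClosed_isCoplanarConormal hsmul
    (x₀ := (specialPlane, c₀, l₀)) (fun k hk => IsCoplanarConormal.eq_zero_of_special hk)
  let θ : ℂ → (Fin 3 → Fin 6 → ℂ) × (Fin 4 → Fin 3 → ℂ) × (Fin 6 → Fin 6 → ℂ) := fun t =>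
    (specialPlane + t • (B - specialPlane), c₀ + t • (c - c₀), l₀ + t • (l - l₀))
  have hθ : Tendsto θ (𝓝 0) (𝓝 (specialPlane, c₀, l₀)) := by
    have : Continuous θ := by fun_prop
    simpa [θ] using this.tendsto 0
  have hγ : Differentiable ℂ fun t => coplanarPt s (θ t).1 (θ t).2.1 (θ t).2.2 := by
    refine differentiable_secantPt (by fun_prop) ?_
    rw [differentiable_pi]
    rintro (r | r)
    · simp only [coplanarVectors, Sum.elim_inl, θ, Pi.add_apply, Pi.smul_apply]
      fun_prop
    · simp only [coplanarVectors, Sum.elim_inr, θ, Pi.add_apply, Pi.smul_apply]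
      fun_prop
  ext i j m
  have h := (differentiable_gradTensor (s := s) P hγ i j m).eq_zero_of_eventually (z := 0) (by
    filter_upwards [hθ.eventually hev] with t ht
    rw [ht _ (isCoplanarConormal_gradTensor hs hP hdef _ _ _)]
    rfl) 1
  simpa [θ] using h

end Coplanar

section CoplanarEquation

/-- The cubic in three vectors `L j` with coefficients `g`, polarized by `tri k`. -/
def planeCubic {R : Type*} [CommRing R] (k : Fin 6 → Fin 6 → Fin 6 → R) (g : Fin 10 → R)
    (L : Fin 3 → Fin 6 → R) : R :=
  g 0 * tri k (L 0) (L 0) (L 0) + g 1 * tri k (L 0) (L 0) (L 1) +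
    g 2 * tri k (L 0) (L 0) (L 2) + g 3 * tri k (L 0) (L 1) (L 1) +
    g 4 * tri k (L 0) (L 1) (L 2) + g 5 * tri k (L 0) (L 2) (L 2) +
    g 6 * tri k (L 1) (L 1) (L 1) + g 7 * tri k (L 1) (L 1) (L 2) +
    g 8 * tri k (L 1) (L 2) (L 2) + g 9 * tri k (L 2) (L 2) (L 2)

/-- The vectors spanning a graph of a linear map from the first three coordinates to the last
three. -/
def graphPlane {R : Type*} [CommRing R] (M : Fin 3 → Fin 3 → R) (j : Fin 3) : Fin 6 → R :=
  ![(1 : Matrix (Fin 3) (Fin 3) R) j 0, (1 : Matrix (Fin 3) (Fin 3) R) j 1,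
    (1 : Matrix (Fin 3) (Fin 3) R) j 2, M j 0, M j 1, M j 2]

theorem tri_sum_three {k : Fin 6 → Fin 6 → Fin 6 → ℂ} (hk : IsSymTensor k)
    (x : Fin 3 → ℂ) (L : Fin 3 → Fin 6 → ℂ) :
    tri k (∑ j, x j • L j) (∑ j, x j • L j) (∑ j, x j • L j) =
      planeCubic k ![x 0 ^ 3, 3 * x 0 ^ 2 * x 1, 3 * x 0 ^ 2 * x 2, 3 * x 0 * x 1 ^ 2,
        6 * x 0 * x 1 * x 2, 3 * x 0 * x 2 ^ 2, x 1 ^ 3, 3 * x 1 ^ 2 * x 2, 3 * x 1 * x 2 ^ 2,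
        x 2 ^ 3] L := by
  have h₁ : ∀ u : Fin 6 → ℂ, ∀ v w, tri k v u w = tri k u v w := fun u v w => hk.tri_swap_left v u w
  have h₂ : ∀ u : Fin 6 → ℂ, ∀ v w, tri k v w u = tri k u v w := fun u v w => by
    rw [hk.tri_swap_right, h₁]
  have e₁ : ∀ v w, tri k (∑ j, x j • L j) v w = x 0 * tri k (L 0) v w + x 1 * tri k (L 1) v w +
      x 2 * tri k (L 2) v w := fun v w => by
    rw [tri_sum_smul_left, Fin.sum_univ_three]
  have e₂ : ∀ v w, tri k v (∑ j, x j • L j) w = x 0 * tri k (L 0) v w + x 1 * tri k (L 1) v w +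
      x 2 * tri k (L 2) v w := fun v w => by rw [h₁, e₁]
  have e₃ : ∀ v w, tri k v w (∑ j, x j • L j) = x 0 * tri k (L 0) v w + x 1 * tri k (L 1) v w +
      x 2 * tri k (L 2) v w := fun v w => by rw [h₂, e₁]
  simp only [e₁, e₂, e₃, planeCubic]
  have p₁ : ∀ u v, tri k v u u = tri k u u v := fun u v => by rw [h₁, hk.tri_swap_right]
  have p₂ : ∀ u v, tri k u v u = tri k u u v := fun u v => hk.tri_swap_right _ _ _
  simp only [p₁ (L 0) (L 1), p₁ (L 0) (L 2), p₁ (L 1) (L 2), p₂ (L 0) (L 1), p₂ (L 0) (L 2),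
    p₂ (L 1) (L 2), h₁ (L 0) (L 1) (L 1), h₁ (L 0) (L 2) (L 2), h₁ (L 1) (L 2) (L 2),
    h₂ (L 0) (L 1) (L 1), h₂ (L 0) (L 2) (L 2), h₂ (L 1) (L 2) (L 2), h₁ (L 0) (L 1) (L 2),
    h₁ (L 0) (L 2) (L 1), h₂ (L 0) (L 1) (L 2), h₂ (L 0) (L 2) (L 1),
    hk.tri_swap_right (L 0) (L 2) (L 1)]
  simp
  ring

/-- Sums of ten cubes, four of them coplanar, satisfy a nontrivial polynomial equation. -/
theorem exists_ne_zero_eval_coplanarPt {ι : Type} [Fintype ι] (hι : Fintype.card ι = 56)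
    {s : Fin 6 → Fin 6 → Fin 6 → ι → ℂ} (hs : IsSymTensor s) :
    ∃ P : MvPolynomial ι ℂ, P ≠ 0 ∧ ∀ B c l, eval (coplanarPt s B c l) P = 0 := by
  have hsn : ∀ n, IsSymTensor fun i j l => s i j l n := fun n i j l =>
    ⟨congrFun (hs i j l).1 n, congrFun (hs i j l).2 n⟩
  let σ := Fin 10 ⊕ (Fin 3 × Fin 3) ⊕ (Fin 6 × Fin 6)
  let p : ι → MvPolynomial σ ℂ := fun n =>
    planeCubic (fun i j l => C (s i j l n)) (fun m => X (Sum.inl m))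
      (graphPlane fun a b => X (Sum.inr (Sum.inl (a, b)))) +
    ∑ i, tri (fun i j l => C (s i j l n)) (fun m => X (Sum.inr (Sum.inr (i, m))))
      (fun m => X (Sum.inr (Sum.inr (i, m)))) (fun m => X (Sum.inr (Sum.inr (i, m))))
  obtain ⟨P, hP, hv⟩ := exists_relation_of_card_lt (by simp [σ, hι]) p
  refine ⟨P, hP, ?_⟩
  have hgraph : ∀ (g : Fin 10 → ℂ) (M : Fin 3 → Fin 3 → ℂ) (l : Fin 6 → Fin 6 → ℂ),
      eval (fun n => planeCubic (fun i j l => s i j l n) g (graphPlane M) +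
      ∑ i, cubePt s (l i) n) P = 0 := by
    intro g M l
    have hpl : ∀ (y : σ → ℂ) (j : Fin 3), (fun i => eval y (graphPlane (R := MvPolynomial σ ℂ)
        (fun a b => X (Sum.inr (Sum.inl (a, b)))) j i)) =
        graphPlane (fun a b => y (Sum.inr (Sum.inl (a, b)))) j := by
      intro y j
      have h1 : ∀ b, eval y ((1 : Matrix (Fin 3) (Fin 3) (MvPolynomial σ ℂ)) j b) =
          (1 : Matrix (Fin 3) (Fin 3) ℂ) j b := fun b => by
        rw [Matrix.one_apply, Matrix.one_apply]
        split_ifs <;> simp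
      ext i
      fin_cases i <;> simp [graphPlane, h1]
    refine Eq.trans ?_ (hv (Sum.elim g (Sum.elim (fun ab => M ab.1 ab.2) fun im => l im.1 im.2)))
    refine congrArg (fun z => eval z P) (funext fun n => ?_)
    simp only [p, planeCubic, map_add, map_sum, map_mul, map_tri, eval_C, eval_X, Sum.elim_inl,
      Sum.elim_inr, hpl, cubePt]
  have hinv : ∀ (B : Fin 3 → Fin 6 → ℂ) (c : Fin 4 → Fin 3 → ℂ) (l : Fin 6 → Fin 6 → ℂ),
      (Matrix.of fun a b : Fin 3 => B a (Fin.castLE (by norm_num) b)).det ≠ 0 →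
      eval (coplanarPt s B c l) P = 0 := by
    intro B c l hB
    set N := Matrix.of fun a b : Fin 3 => B a (Fin.castLE (by norm_num) b) with hN
    let M : Fin 3 → Fin 3 → ℂ := N⁻¹ * Matrix.of fun a b : Fin 3 => B a (Fin.natAdd 3 b)
    have hNM : N * Matrix.of M = Matrix.of fun a b : Fin 3 => B a (Fin.natAdd 3 b) := by
      change N * (N⁻¹ * _) = _
      rw [← mul_assoc, Matrix.mul_nonsing_inv _ (isUnit_iff_ne_zero.2 hB), one_mul]
    have hBL : ∀ j, B j = ∑ m, N j m • graphPlane M m := by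
      intro j
      have h := fun b => congrFun (congrFun hNM j) b
      simp only [Matrix.mul_apply, Matrix.of_apply, Fin.sum_univ_three] at h
      ext i
      rw [Fin.sum_univ_three]
      fin_cases i
      · simp [graphPlane, hN]
      · simp [graphPlane, hN]
      · simp [graphPlane, hN]
      · simpa [graphPlane] using (h 0).symm
      · simpa [graphPlane] using (h 1).symm
      · simpa [graphPlane] using (h 2).symm
    let x : Fin 4 → Fin 3 → ℂ := fun i m => ∑ j, c i j * N j m
    have hx : ∀ i, ∑ j, c i j • B j = ∑ m, x i m • graphPlane M m := by
      intro i
      simp only [hBL, Finset.smul_sum, smul_smul, x, Finset.sum_smul]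
      exact Finset.sum_comm
    refine Eq.trans ?_ (hgraph (∑ i, ![x i 0 ^ 3, 3 * x i 0 ^ 2 * x i 1, 3 * x i 0 ^ 2 * x i 2,
      3 * x i 0 * x i 1 ^ 2, 6 * x i 0 * x i 1 * x i 2, 3 * x i 0 * x i 2 ^ 2, x i 1 ^ 3,
      3 * x i 1 ^ 2 * x i 2, 3 * x i 1 * x i 2 ^ 2, x i 2 ^ 3]) M l)
    refine congrArg (fun z => eval z P) (funext fun n => ?_)
    simp only [coplanarPt, secantPt, coplanarVectors, Fintype.sum_sum_type, Sum.elim_inl,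
      Sum.elim_inr, one_smul, Finset.sum_apply]
    congr 1
    simp only [cubePt, hx, tri_sum_three (hsn n), planeCubic, Finset.sum_apply, Finset.sum_mul,
      Finset.sum_add_distrib]
  intro B c l
  let N : ℂ → Matrix (Fin 3) (Fin 3) ℂ := fun t => Matrix.of fun a b =>
    (B + t • (graphPlane 0 - B) : Fin 3 → Fin 6 → ℂ) a (Fin.castLE (by norm_num) b)
  have hN : Differentiable ℂ fun t => (N t).det := by
    simp only [Matrix.det_fin_three, N, Matrix.of_apply, Pi.add_apply, Pi.smul_apply]
    fun_prop
  have hN1 : (N 1).det ≠ 0 := by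
    have : N 1 = 1 := by
      ext a b
      have : N 1 a b = graphPlane (R := ℂ) 0 a (Fin.castLE (by norm_num) b) := by simp [N]
      rw [this]
      fin_cases b <;> rfl
    simp [this]
  have hd : Differentiable ℂ fun t : ℂ => eval (coplanarPt s (B + t • (graphPlane 0 - B)) c l) P := by
    refine P.differentiable_eval_comp (differentiable_secantPt (by fun_prop) ?_)
    rw [differentiable_pi]
    rintro (r | r)
    · simp only [coplanarVectors, Sum.elim_inl, Pi.add_apply, Pi.smul_apply]
      fun_prop
    · simp only [coplanarVectors, Sum.elim_inr]
      fun_prop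
  by_contra hne
  obtain ⟨t, h₁, h₂⟩ := ((hN.eventually_ne_zero hN1 0).and
    (hd.eventually_ne_zero (a := 0) (by simpa using hne) 0)).exists
  exact h₂ (hinv _ c l h₁)

end CoplanarEquation

/-! ### The Veronese surface and the determinantal cubic -/

section Veronese

/-- The Veronese map by monomials of degree two. -/
def monVeronese (w : Fin 3 → ℂ) : Fin 6 → ℂ :=
  ![w 0 ^ 2, w 0 * w 1, w 0 * w 2, w 1 ^ 2, w 1 * w 2, w 2 ^ 2]

/-- The tensor of the determinant of the generic symmetric `3 × 3` matrix, up to a factor, with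
integral coefficients. -/
def detTensorInt : Fin 6 → Fin 6 → Fin 6 → ℤ :=
  ![!![0, 0, 0, 0, 0, 0; 0, 0, 0, 0, 0, 0; 0, 0, 0, 0, 0, 0;
      0, 0, 0, 0, 0, 1; 0, 0, 0, 0, -2, 0; 0, 0, 0, 1, 0, 0],
    !![0, 0, 0, 0, 0, 0; 0, 0, 0, 0, 0, -2; 0, 0, 0, 0, 2, 0;
      0, 0, 0, 0, 0, 0; 0, 0, 2, 0, 0, 0; 0, -2, 0, 0, 0, 0],
    !![0, 0, 0, 0, 0, 0; 0, 0, 0, 0, 2, 0; 0, 0, 0, -2, 0, 0;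
      0, 0, -2, 0, 0, 0; 0, 2, 0, 0, 0, 0; 0, 0, 0, 0, 0, 0],
    !![0, 0, 0, 0, 0, 1; 0, 0, 0, 0, 0, 0; 0, 0, -2, 0, 0, 0;
      0, 0, 0, 0, 0, 0; 0, 0, 0, 0, 0, 0; 1, 0, 0, 0, 0, 0],
    !![0, 0, 0, 0, -2, 0; 0, 0, 2, 0, 0, 0; 0, 2, 0, 0, 0, 0;
      0, 0, 0, 0, 0, 0; -2, 0, 0, 0, 0, 0; 0, 0, 0, 0, 0, 0],
    !![0, 0, 0, 1, 0, 0; 0, -2, 0, 0, 0, 0; 0, 0, 0, 0, 0, 0;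
      1, 0, 0, 0, 0, 0; 0, 0, 0, 0, 0, 0; 0, 0, 0, 0, 0, 0]]

/-- The tensor of the determinant of the generic symmetric `3 × 3` matrix, up to a factor. -/
def detTensor (i j l : Fin 6) : ℂ := detTensorInt i j l

theorem isSymTensor_detTensor : IsSymTensor detTensor := by
  have h : ∀ i j l, detTensorInt i j l = detTensorInt j i l ∧
      detTensorInt i j l = detTensorInt i l j := by decide
  exact fun i j l => ⟨congrArg _ (h i j l).1, congrArg _ (h i j l).2⟩

theorem polarMatrix_detTensor (x : Fin 6 → ℂ) : polarMatrix detTensor x =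
    !![0, 0, 0, x 5, -2 * x 4, x 3; 0, -2 * x 5, 2 * x 4, 0, 2 * x 2, -2 * x 1;
      0, 2 * x 4, -2 * x 3, -2 * x 2, 2 * x 1, 0; x 5, 0, -2 * x 2, 0, 0, x 0;
      -2 * x 4, 2 * x 2, 2 * x 1, 0, -2 * x 0, 0; x 3, -2 * x 1, 0, x 0, 0, 0] := by
  ext i j
  fin_cases i <;> fin_cases j <;>
    simp [polarMatrix, detTensor, detTensorInt, Fin.sum_univ_six]

theorem tri_eq_sum_polarMatrix (k : Fin 6 → Fin 6 → Fin 6 → ℂ) (x u v : Fin 6 → ℂ) :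
    tri k u v x = ∑ i, ∑ j, polarMatrix k x i j * (u i * v j) := by
  simp only [tri, polarMatrix, Matrix.of_apply, Finset.sum_mul]
  exact Finset.sum_congr rfl fun i _ => Finset.sum_congr rfl fun j _ =>
    Finset.sum_congr rfl fun l _ => by ring

theorem tri_detTensor_monVeronese (w : Fin 3 → ℂ) (y : Fin 6 → ℂ) :
    tri detTensor (monVeronese w) (monVeronese w) y = 0 := by
  rw [tri_eq_sum_polarMatrix, polarMatrix_detTensor]
  simp [Fin.sum_univ_six, monVeronese]
  ring

theorem tri_detTensor (x : Fin 6 → ℂ) : tri detTensor x x x =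
    6 * (x 0 * x 3 * x 5 + 2 * x 1 * x 2 * x 4 - x 0 * x 4 ^ 2 - x 3 * x 2 ^ 2 -
      x 5 * x 1 ^ 2) := by
  rw [tri_eq_sum_polarMatrix, polarMatrix_detTensor]
  simp [Fin.sum_univ_six]
  ring

set_option maxHeartbeats 1000000 in
theorem det_polarMatrix_detTensor (x : Fin 6 → ℂ) : (polarMatrix detTensor x).det =
    -16 * (x 0 * x 3 * x 5 + 2 * x 1 * x 2 * x 4 - x 0 * x 4 ^ 2 - x 3 * x 2 ^ 2 -
      x 5 * x 1 ^ 2) ^ 2 := by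
  rw [polarMatrix_detTensor]
  simp [Matrix.det_succ_row_zero, Fin.sum_univ_succ, Fin.succAbove]
  ring

theorem hessianDefect_detTensor (x y : Fin 6 → ℂ) : hessianDefect detTensor x y = 0 := by
  rw [hessianDefect, det_polarMatrix_detTensor, det_polarMatrix_detTensor, tri_detTensor,
    tri_detTensor]
  ring

end Veronese

/-! ### Tensors conormal to the family of Veronese-apolar cubics -/



theorem coeff_eq_zero_of_sum_mul_pow_eq_zero {N : ℕ} {m : ℕ → ℂ}
    (h : ∀ x : ℂ, ∑ a ∈ Finset.range N, m a * x ^ a = 0) {a : ℕ} (ha : a < N) : m a = 0 := by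
  have hp : ∑ a ∈ Finset.range N, Polynomial.C (m a) * Polynomial.X ^ a = 0 :=
    Polynomial.funext fun x => by simpa [Polynomial.eval_finsetSum] using h x
  simpa [Polynomial.finsetSum_coeff, Polynomial.coeff_X_pow, ha] using
    congrArg (Polynomial.coeff · a) hp

theorem coeff_eq_zero_of_sum_mul_pow_mul_pow_eq_zero {N : ℕ} {m : ℕ → ℕ → ℂ}
    (h : ∀ x y : ℂ, ∑ a ∈ Finset.range N, ∑ b ∈ Finset.range N, m a b * (x ^ a * y ^ b) = 0)
    {a b : ℕ} (ha : a < N) (hb : b < N) : m a b = 0 := by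
  refine coeff_eq_zero_of_sum_mul_pow_eq_zero (m := m a) (fun y => ?_) hb
  refine coeff_eq_zero_of_sum_mul_pow_eq_zero
    (m := fun a => ∑ b ∈ Finset.range N, m a b * y ^ b) (fun x => ?_) ha
  rw [← h x y]
  refine Finset.sum_congr rfl fun a _ => ?_
  rw [Finset.sum_mul]
  exact Finset.sum_congr rfl fun b _ => by ring

/-- The exponents of the monomials of `monVeronese`. -/
def veroneseExp : Fin 6 → Fin 3 → ℕ :=
  ![![2, 0, 0], ![1, 1, 0], ![1, 0, 1], ![0, 2, 0], ![0, 1, 1], ![0, 0, 2]]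

theorem monVeronese_apply (w : Fin 3 → ℂ) (i : Fin 6) : monVeronese w i =
    w 0 ^ veroneseExp i 0 * w 1 ^ veroneseExp i 1 * w 2 ^ veroneseExp i 2 := by
  fin_cases i <;> simp [monVeronese, veroneseExp]

/-- The restriction of a cubic form to the Veronese surface vanishes coefficientwise. -/
theorem sum_ite_eq_zero_of_tri_monVeronese {k : Fin 6 → Fin 6 → Fin 6 → ℂ}
    (h : ∀ w, tri k (monVeronese w) (monVeronese w) (monVeronese w) = 0) {a b : ℕ} (ha : a < 7)
    (hb : b < 7) : ∑ t : Fin 6 × Fin 6 × Fin 6,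
      (if veroneseExp t.1 1 + veroneseExp t.2.1 1 + veroneseExp t.2.2 1 = a ∧
      veroneseExp t.1 2 + veroneseExp t.2.1 2 + veroneseExp t.2.2 2 = b then
        k t.1 t.2.1 t.2.2 else 0) = 0 := by
  have hlt : ∀ i j l n, veroneseExp i n + veroneseExp j n + veroneseExp l n < 7 := by decide
  refine coeff_eq_zero_of_sum_mul_pow_mul_pow_eq_zero (N := 7)
    (m := fun a b => ∑ t : Fin 6 × Fin 6 × Fin 6,
      (if veroneseExp t.1 1 + veroneseExp t.2.1 1 + veroneseExp t.2.2 1 = a ∧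
      veroneseExp t.1 2 + veroneseExp t.2.1 2 + veroneseExp t.2.2 2 = b then
        k t.1 t.2.1 t.2.2 else 0)) (fun x y => ?_) ha hb
  have hw : ∀ i, monVeronese ![1, x, y] i = x ^ veroneseExp i 1 * y ^ veroneseExp i 2 := fun i => by
    rw [monVeronese_apply]
    simp
  have hk : ∑ t : Fin 6 × Fin 6 × Fin 6, k t.1 t.2.1 t.2.2 * (monVeronese ![1, x, y] t.1 *
      monVeronese ![1, x, y] t.2.1 * monVeronese ![1, x, y] t.2.2) = 0 := by
    rw [← h ![1, x, y]]
    simp only [tri, Fintype.sum_prod_type]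
  refine Eq.trans ?_ hk
  simp only [Finset.sum_mul]
  rw [Finset.sum_congr rfl fun a _ => Finset.sum_comm, Finset.sum_comm]
  refine Finset.sum_congr rfl fun t _ => ?_
  rw [Finset.sum_eq_single (veroneseExp t.1 1 + veroneseExp t.2.1 1 + veroneseExp t.2.2 1),
    Finset.sum_eq_single (veroneseExp t.1 2 + veroneseExp t.2.1 2 + veroneseExp t.2.2 2)]
  · rw [if_pos ⟨rfl, rfl⟩, hw, hw, hw]
    ring
  · exact fun b _ hb => by rw [if_neg fun h => hb h.2.symm, zero_mul]
  · exact fun h => absurd (Finset.mem_range.2 (hlt _ _ _ _)) h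
  · exact fun a _ ha => Finset.sum_eq_zero fun b _ => by
      rw [if_neg fun h => ha h.1.symm, zero_mul]
  · exact fun h => absurd (Finset.mem_range.2 (hlt _ _ _ _)) h

/-- The points of the Veronese surface supporting the special cubic. -/
noncomputable def basePoint (r : Fin 3 × Fin 4) : Fin 3 → ℂ :=
  ![![1, Complex.I ^ (r.2 : ℕ), 0], ![0, 1, Complex.I ^ (r.2 : ℕ)],
    ![1, 0, Complex.I ^ (r.2 : ℕ)]] r.1

/-- The coefficients of the special cubic. -/
noncomputable def baseCoeff (r : Fin 3 × Fin 4) : ℂ := Complex.I ^ (r.2 : ℕ) / 4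

theorem sum_I_pow_mul_pow (b : ℕ) :
    ∑ m : Fin 4, Complex.I ^ (m : ℕ) / 4 * (Complex.I ^ (m : ℕ)) ^ b =
      if b % 4 = 3 then 1 else 0 := by
  have h4 : ∀ m : ℕ, (Complex.I ^ m) ^ b = (Complex.I ^ m) ^ (b % 4) := fun m => by
    have h1 : (Complex.I ^ m) ^ 4 = 1 := by
      rw [← pow_mul, mul_comm, pow_mul, Complex.I_pow_four, one_pow]
    conv_lhs => rw [← Nat.div_add_mod b 4, pow_add, pow_mul, h1, one_pow, one_mul]
  simp only [h4]
  have hlt : b % 4 < 4 := Nat.mod_lt _ (by norm_num)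
  generalize b % 4 = r at hlt
  have h2 := Complex.I_sq
  rw [Fin.sum_univ_four]
  change Complex.I ^ 0 / 4 * (Complex.I ^ 0) ^ r + Complex.I ^ 1 / 4 * (Complex.I ^ 1) ^ r +
    Complex.I ^ 2 / 4 * (Complex.I ^ 2) ^ r + Complex.I ^ 3 / 4 * (Complex.I ^ 3) ^ r = _
  interval_cases r
  all_goals
    norm_num
    grind

/-- The moments of the special cubic. -/
def baseMoment (a b c : ℕ) : ℕ :=
  (if c = 0 ∧ b % 4 = 3 then 1 else 0) + (if a = 0 ∧ c % 4 = 3 then 1 else 0) +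
    if b = 0 ∧ c % 4 = 3 then 1 else 0

theorem sum_baseCoeff_mul (a b c : ℕ) :
    ∑ r, baseCoeff r * (basePoint r 0 ^ a * basePoint r 1 ^ b * basePoint r 2 ^ c) =
      baseMoment a b c := by
  have e₀ : ∀ m : Fin 4, basePoint (0, m) = ![1, Complex.I ^ (m : ℕ), 0] := fun _ => rfl
  have e₁ : ∀ m : Fin 4, basePoint (1, m) = ![0, 1, Complex.I ^ (m : ℕ)] := fun _ => rfl
  have e₂ : ∀ m : Fin 4, basePoint (2, m) = ![1, 0, Complex.I ^ (m : ℕ)] := fun _ => rfl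
  simp only [Fintype.sum_prod_type, Fin.sum_univ_three, baseCoeff, e₀, e₁, e₂, baseMoment]
  have h₀ : ∀ n : ℕ, (0 : ℂ) ^ n = if n = 0 then 1 else 0 := fun n => by
    split_ifs with h <;> simp [h]
  push_cast
  congr 1
  · congr 1
    · rw [ite_and, ← sum_I_pow_mul_pow b]
      split_ifs with h <;> simp [h]
    · rw [ite_and, ← sum_I_pow_mul_pow c]
      split_ifs with h <;> simp [h]
  · rw [ite_and, ← sum_I_pow_mul_pow c]
    split_ifs with h <;> simp [h]

/-- The tensors orthogonal to the tangent directions, at the cubic with tensor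
`∑ r, c r • (monVeronese (w r)) ^ 3`, of the family of Veronese-apolar cubics. -/
def IsVeroneseConormal {κ : Type*} [Fintype κ] (c : κ → ℂ) (w : κ → Fin 3 → ℂ)
    (k : Fin 6 → Fin 6 → Fin 6 → ℂ) : Prop :=
  IsSymTensor k ∧ (∀ w', tri k (monVeronese w') (monVeronese w') (monVeronese w') = 0) ∧
    ∀ p y, ∑ r, c r * (monVeronese (w r) p * tri k (monVeronese (w r)) (monVeronese (w r)) y) = 0

theorem IsVeroneseConormal.sum_mul_baseMoment {k : Fin 6 → Fin 6 → Fin 6 → ℂ}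
    (hk : IsVeroneseConormal baseCoeff basePoint k) (p q : Fin 6) :
    ∑ i, ∑ j, (baseMoment (veroneseExp p 0 + veroneseExp i 0 + veroneseExp j 0)
      (veroneseExp p 1 + veroneseExp i 1 + veroneseExp j 1)
      (veroneseExp p 2 + veroneseExp i 2 + veroneseExp j 2) : ℂ) * k i j q = 0 := by
  rw [← hk.2.2 p (Pi.single q 1)]
  simp only [tri, Pi.single_apply, mul_ite, mul_one, mul_zero, Finset.sum_ite_eq',
    Finset.mem_univ, if_true, ← sum_baseCoeff_mul, Finset.sum_mul, Finset.mul_sum]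
  rw [Finset.sum_congr rfl fun i _ => Finset.sum_comm, Finset.sum_comm]
  refine Finset.sum_congr rfl fun r _ => Finset.sum_congr rfl fun i _ =>
    Finset.sum_congr rfl fun j _ => ?_
  simp only [monVeronese_apply]
  ring


set_option maxHeartbeats 2000000 in
theorem IsVeroneseConormal.eq_zero_of_base {k : Fin 6 → Fin 6 → Fin 6 → ℂ}
    (hk : IsVeroneseConormal baseCoeff basePoint k) (h₀ : k 0 3 5 = 0) : k = 0 := by
  have hl : ∀ i j l, k i j l = k j i l := fun i j l => (hk.1 i j l).1
  have hr : ∀ i j l, k i j l = k i l j := fun i j l => (hk.1 i j l).2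
  have hm := hk.sum_mul_baseMoment
  have hv := fun a b ha hb => sum_ite_eq_zero_of_tri_monVeronese hk.2.1 (a := a) (b := b) ha hb
  have v00 := hv 0 0 (by norm_num) (by norm_num)
  have v01 := hv 0 1 (by norm_num) (by norm_num)
  have v02 := hv 0 2 (by norm_num) (by norm_num)
  have v03 := hv 0 3 (by norm_num) (by norm_num)
  have v04 := hv 0 4 (by norm_num) (by norm_num)
  have v05 := hv 0 5 (by norm_num) (by norm_num)
  have v06 := hv 0 6 (by norm_num) (by norm_num)
  have v10 := hv 1 0 (by norm_num) (by norm_num)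
  have v11 := hv 1 1 (by norm_num) (by norm_num)
  have v12 := hv 1 2 (by norm_num) (by norm_num)
  have v13 := hv 1 3 (by norm_num) (by norm_num)
  have v14 := hv 1 4 (by norm_num) (by norm_num)
  have v15 := hv 1 5 (by norm_num) (by norm_num)
  have v20 := hv 2 0 (by norm_num) (by norm_num)
  have v21 := hv 2 1 (by norm_num) (by norm_num)
  have v22 := hv 2 2 (by norm_num) (by norm_num)
  have v23 := hv 2 3 (by norm_num) (by norm_num)
  have v24 := hv 2 4 (by norm_num) (by norm_num)
  have v30 := hv 3 0 (by norm_num) (by norm_num)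
  have v31 := hv 3 1 (by norm_num) (by norm_num)
  have v32 := hv 3 2 (by norm_num) (by norm_num)
  have v33 := hv 3 3 (by norm_num) (by norm_num)
  have v40 := hv 4 0 (by norm_num) (by norm_num)
  have v41 := hv 4 1 (by norm_num) (by norm_num)
  have v42 := hv 4 2 (by norm_num) (by norm_num)
  have v50 := hv 5 0 (by norm_num) (by norm_num)
  have v51 := hv 5 1 (by norm_num) (by norm_num)
  have v60 := hv 6 0 (by norm_num) (by norm_num)
  have m00 := hm 0 0
  have m01 := hm 0 1
  have m02 := hm 0 2
  have m03 := hm 0 3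
  have m04 := hm 0 4
  have m05 := hm 0 5
  have m10 := hm 1 0
  have m11 := hm 1 1
  have m12 := hm 1 2
  have m13 := hm 1 3
  have m14 := hm 1 4
  have m15 := hm 1 5
  have m20 := hm 2 0
  have m21 := hm 2 1
  have m22 := hm 2 2
  have m23 := hm 2 3
  have m24 := hm 2 4
  have m25 := hm 2 5
  have m30 := hm 3 0
  have m31 := hm 3 1
  have m32 := hm 3 2
  have m33 := hm 3 3
  have m34 := hm 3 4
  have m35 := hm 3 5
  have m40 := hm 4 0
  have m41 := hm 4 1
  have m42 := hm 4 2
  have m43 := hm 4 3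
  have m44 := hm 4 4
  have m45 := hm 4 5
  have m50 := hm 5 0
  have m51 := hm 5 1
  have m52 := hm 5 2
  have m53 := hm 5 3
  have m54 := hm 5 4
  have m55 := hm 5 5
  clear hm hv
  simp [Fintype.sum_prod_type, Fin.sum_univ_six, veroneseExp, hl, hr] at v00 v01 v02 v03 v04 v05 v06 v10 v11 v12 v13 v14 v15 v20 v21 v22 v23 v24 v30 v31 v32 v33 v40 v41 v42 v50 v51 v60
  simp [Fin.sum_univ_six, veroneseExp, baseMoment, hl, hr] at m00 m01 m02 m03 m04 m05 m10 m11 m12 m13 m14 m15 m20 m21 m22 m23 m24 m25 m30 m31 m32 m33 m34 m35 m40 m41 m42 m43 m44 m45 m50 m51 m52 m53 m54 m55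
  have hs := hk.1
  clear hk hl hr
  refine hs.eq_zero_of_sorted fun i j l hij hjl => ?_
  clear hs
  fin_cases i <;> fin_cases j <;> first | exact absurd hij (by decide) | fin_cases l
  all_goals first
    | exact absurd hjl (by decide)
    | (clear hij hjl; dsimp only [Fin.mk_zero, Fin.mk_one, Fin.reduceFinMk]; grind)

theorem IsVeroneseConormal.smul {κ : Type*} [Fintype κ] {c : κ → ℂ} {w : κ → Fin 3 → ℂ}
    {k : Fin 6 → Fin 6 → Fin 6 → ℂ} (hk : IsVeroneseConormal c w k) (a : ℂ) :
    IsVeroneseConormal c w (a • k) := by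
  refine ⟨hk.1.smul a, fun w' => ?_, fun p y => ?_⟩
  · rw [tri_smul_tensor, hk.2.1, mul_zero]
  · simp only [tri_smul_tensor, mul_left_comm _ a, ← Finset.mul_sum, hk.2.2, mul_zero]

theorem tri_sub_tensor (k k' : Fin 6 → Fin 6 → Fin 6 → ℂ) (u v w : Fin 6 → ℂ) :
    tri (k - k') u v w = tri k u v w - tri k' u v w := by
  simp only [tri, Pi.sub_apply, sub_mul, Finset.sum_sub_distrib]

theorem IsVeroneseConormal.sub {κ : Type*} [Fintype κ] {c : κ → ℂ} {w : κ → Fin 3 → ℂ}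
    {k k' : Fin 6 → Fin 6 → Fin 6 → ℂ} (hk : IsVeroneseConormal c w k)
    (hk' : IsVeroneseConormal c w k') : IsVeroneseConormal c w (k - k') := by
  refine ⟨fun i j l => ?_, fun w' => ?_, fun p y => ?_⟩
  · simp only [Pi.sub_apply]
    rw [← (hk.1 i j l).1, ← (hk.1 i j l).2, ← (hk'.1 i j l).1, ← (hk'.1 i j l).2]
    exact ⟨rfl, rfl⟩
  · rw [tri_sub_tensor, hk.2.1, hk'.2.1, sub_zero]
  · simp only [tri_sub_tensor, mul_sub, Finset.sum_sub_distrib, hk.2.2, hk'.2.2, sub_zero]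

theorem isVeroneseConormal_detTensor {κ : Type*} [Fintype κ] (c : κ → ℂ) (w : κ → Fin 3 → ℂ) :
    IsVeroneseConormal c w detTensor :=
  ⟨isSymTensor_detTensor, fun w' => tri_detTensor_monVeronese w' _, fun p y => by
    simp [tri_detTensor_monVeronese]⟩

theorem isClosed_isVeroneseConormal {κ : Type*} [Fintype κ] (w : κ → Fin 3 → ℂ) :
    IsClosed {p : (κ → ℂ) × (Fin 6 → Fin 6 → Fin 6 → ℂ) |
      IsVeroneseConormal p.1 w p.2 ∧ p.2 0 3 5 = 0} := by
  simp only [IsVeroneseConormal, IsSymTensor, tri, Set.ofPred_and, Set.ofPred_forall]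
  refine IsClosed.inter (IsClosed.inter ?_ (IsClosed.inter ?_ ?_))
    (isClosed_eq (by fun_prop) (by fun_prop))
  · exact isClosed_iInter fun i => isClosed_iInter fun j => isClosed_iInter fun l =>
      (isClosed_eq (by fun_prop) (by fun_prop)).inter (isClosed_eq (by fun_prop) (by fun_prop))
  · exact isClosed_iInter fun i => isClosed_eq (by fun_prop) (by fun_prop)
  · exact isClosed_iInter fun i => isClosed_iInter fun j => isClosed_eq (by fun_prop) (by fun_prop)

/-- Near the special cubic, all conormal tensors are multiples of `detTensor`. -/
theorem eventually_isVeroneseConormal_hessianDefect_eq_zero {κ : Type*} [Fintype κ]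
    (w : κ → Fin 3 → ℂ) :
    ∀ᶠ c : (Fin 3 × Fin 4) ⊕ κ → ℂ in 𝓝 (Sum.elim baseCoeff 0), ∀ k,
      IsVeroneseConormal c (Sum.elim basePoint w) k → ∀ x y, hessianDefect k x y = 0 := by
  have h := eventually_forall_eq_zero_of_isClosed
    (F := fun (c : (Fin 3 × Fin 4) ⊕ κ → ℂ) (k : Fin 6 → Fin 6 → Fin 6 → ℂ) =>
      IsVeroneseConormal c (Sum.elim basePoint w) k ∧ k 0 3 5 = 0)
    (isClosed_isVeroneseConormal _) (fun c k a hk => ⟨hk.1.smul a, by simp [hk.2]⟩)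
    (x₀ := Sum.elim baseCoeff 0) (by
      rintro k ⟨hk, h₀⟩
      refine IsVeroneseConormal.eq_zero_of_base ⟨hk.1, hk.2.1, fun p y => ?_⟩ h₀
      simpa using hk.2.2 p y)
  filter_upwards [h] with c hc k hk x y
  have hk' : k - k 0 3 5 • detTensor = 0 :=
    hc _ ⟨hk.sub ((isVeroneseConormal_detTensor _ _).smul _), by
      simp [show detTensor 0 3 5 = 1 by simp [detTensor, detTensorInt]]⟩
  rw [sub_eq_zero.1 hk', hessianDefect_smul_tensor, hessianDefect_detTensor, mul_zero]

section VeronesePoint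

variable {ι : Type*} [Fintype ι] {s : Fin 6 → Fin 6 → Fin 6 → ι → ℂ}

/-- A combination of cubes of points of the image under `A` of the Veronese surface. -/
noncomputable def veronesePt {κ : Type*} [Fintype κ] (s : Fin 6 → Fin 6 → Fin 6 → ι → ℂ)
    (A : Matrix (Fin 6) (Fin 6) ℂ) (c : κ → ℂ) (w : κ → Fin 3 → ℂ) : ι → ℂ :=
  secantPt s c fun r => A.mulVec (monVeronese (w r))

theorem eval_veronesePt_eq_zero {P : MvPolynomial ι ℂ} {κ : Type*} [Fintype κ] {c : κ → ℂ}
    {w : κ → Fin 3 → ℂ}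
    (hP : ∀ A : Matrix (Fin 6) (Fin 6) ℂ, A.det ≠ 0 → eval (veronesePt s A c w) P = 0)
    (A : Matrix (Fin 6) (Fin 6) ℂ) : eval (veronesePt s A c w) P = 0 := by
  have hN : Differentiable ℂ fun t : ℂ => (A + t • (1 - A)).det := by
    simp only [Matrix.det_apply, Matrix.add_apply, Matrix.smul_apply]
    fun_prop
  have hd : Differentiable ℂ fun t : ℂ => eval (veronesePt s (A + t • (1 - A)) c w) P := by
    refine P.differentiable_eval_comp (differentiable_secantPt (by fun_prop) ?_)
    simp only [Matrix.add_mulVec, Matrix.smul_mulVec]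
    fun_prop
  by_contra hne
  obtain ⟨t, h₁, h₂⟩ := ((hN.eventually_ne_zero (a := 1) (by simp) 0).and
    (hd.eventually_ne_zero (a := 0) (by simpa using hne) 0)).exists
  exact h₂ (hP _ h₁)

theorem isVeroneseConormal_pullback_gradTensor (hs : IsSymTensor s) {P : MvPolynomial ι ℂ}
    (hP : ∀ (κ : Type) [Fintype κ] (c : κ → ℂ) (w : κ → Fin 3 → ℂ)
      (A : Matrix (Fin 6) (Fin 6) ℂ), A.det ≠ 0 → eval (veronesePt s A c w) P = 0)
    {κ : Type} [Fintype κ] (c : κ → ℂ) (w : κ → Fin 3 → ℂ) (A : Matrix (Fin 6) (Fin 6) ℂ) :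
    IsVeroneseConormal c w (pullback A (gradTensor s P (veronesePt s A c w))) := by
  have hg := isSymTensor_gradTensor hs P (veronesePt s A c w)
  refine ⟨hg.pullback A, fun w' => ?_, fun p y => ?_⟩
  · rw [tri_pullback A hg]
    refine tri_gradTensor_self_eq_zero P _ _ fun t => ?_
    refine Eq.trans ?_ (eval_veronesePt_eq_zero
      (hP (κ ⊕ Unit) (Sum.elim c fun _ => t) (Sum.elim w fun _ => w')) A)
    simp [veronesePt, secantPt]
  · have h := sum_tri_gradTensor_eq_zero hs P c (fun r => A.mulVec (monVeronese (w r)))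
      (fun r => A.mulVec (monVeronese (w r) p • y)) (by
        intro t
        refine Eq.trans ?_ (eval_veronesePt_eq_zero (hP κ c w)
          (A + t • (A * Matrix.vecMulVec y (Pi.single p 1))))
        refine congrArg (fun a => eval (secantPt s c a) P) (funext fun r => ?_)
        simp [Matrix.add_mulVec, Matrix.smul_mulVec, ← Matrix.mulVec_mulVec,
          Matrix.vecMulVec_mulVec])
    refine (Finset.sum_congr rfl fun r _ => ?_).trans h
    rw [tri_pullback A hg, Matrix.mulVec_smul, hg.tri_swap_right, hg.tri_swap_left, ← tri_smul_left,
      hg.tri_swap_left, hg.tri_swap_right]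
    rfl

/-- Conormal tensors of the Veronese-apolar family have vanishing Hessian defect. -/
theorem hessianDefect_gradTensor_veronesePt (hs : IsSymTensor s) {P : MvPolynomial ι ℂ}
    (hP : ∀ (κ : Type) [Fintype κ] (c : κ → ℂ) (w : κ → Fin 3 → ℂ)
      (A : Matrix (Fin 6) (Fin 6) ℂ), A.det ≠ 0 → eval (veronesePt s A c w) P = 0)
    {κ : Type} [Fintype κ] (c : κ → ℂ) (w : κ → Fin 3 → ℂ) {A : Matrix (Fin 6) (Fin 6) ℂ}
    (hA : A.det ≠ 0) (x y : Fin 6 → ℂ) :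
    hessianDefect (gradTensor s P (veronesePt s A c w)) x y = 0 := by
  let θ : ℂ → (Fin 3 × Fin 4) ⊕ κ → ℂ := fun t => Sum.elim ((1 - t) • baseCoeff) (t • c)
  have hθd : Differentiable ℂ θ := by
    rw [differentiable_pi]
    rintro (r | r)
    · simp only [θ, Sum.elim_inl, Pi.smul_apply]
      fun_prop
    · simp only [θ, Sum.elim_inr, Pi.smul_apply]
      fun_prop
  have hθ : Tendsto θ (𝓝 0) (𝓝 (Sum.elim baseCoeff 0)) := by
    simpa [θ] using hθd.continuous.tendsto 0
  have hinv : ∀ z : Fin 6 → ℂ, A.mulVec (A⁻¹.mulVec z) = z := fun z => by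
    rw [Matrix.mulVec_mulVec, Matrix.mul_nonsing_inv _ (isUnit_iff_ne_zero.2 hA), Matrix.one_mulVec]
  have hd : Differentiable ℂ fun t =>
      eval (veronesePt s A (θ t) (Sum.elim basePoint w)) (defectPoly s P x y) :=
    (defectPoly s P x y).differentiable_eval_comp (differentiable_secantPt hθd (by fun_prop))
  have h := hd.eq_zero_of_eventually (z := 0) (by
    filter_upwards [hθ.eventually (eventually_isVeroneseConormal_hessianDefect_eq_zero w)]
      with t ht
    have h := ht _ (isVeroneseConormal_pullback_gradTensor hs hP _ _ A) (A⁻¹.mulVec x)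
      (A⁻¹.mulVec y)
    rw [hessianDefect_pullback A (isSymTensor_gradTensor hs _ _), hinv, hinv] at h
    rw [eval_defectPoly]
    exact (mul_eq_zero.1 h).resolve_left (pow_ne_zero 2 hA)) 1
  rw [eval_defectPoly] at h
  simpa [veronesePt, secantPt, θ] using h

end VeronesePoint

/-! ### Cubes of linear forms and the apolarity pairing -/

section Pairing

variable {n : ℕ}

theorem isHomogeneous_linForm (v : Fin n → ℂ) : (linForm v).IsHomogeneous 1 :=
  IsHomogeneous.sum _ _ _ fun i _ => by simpa using (isHomogeneous_C _ (v i)).mul (isHomogeneous_X _ i)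

theorem linForm_add (u v : Fin n → ℂ) : linForm (u + v) = linForm u + linForm v := by
  simp only [linForm, Pi.add_apply, map_add, add_mul, Finset.sum_add_distrib]

theorem linForm_single (i : Fin n) : linForm (Pi.single i 1) = X i := by
  rw [linForm, Finset.sum_eq_single i (fun j _ hj => by simp [hj]) (by simp)]
  simp

theorem pderiv_linForm (i : Fin n) (v : Fin n → ℂ) : pderiv i (linForm v) = C (v i) := by
  simp only [linForm, map_sum, pderiv_C_mul, pderiv_X]
  rw [Finset.sum_eq_single i (fun j _ hj => by simp [hj]) (by simp)]
  simp

/-- The divided power of a linear form. -/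
noncomputable def linFormDividedPow (v : Fin n → ℂ) (m : ℕ) : MvPolynomial (Fin n) ℂ :=
  C (m.factorial : ℂ)⁻¹ * linForm v ^ m

theorem pderiv_linFormDividedPow (i : Fin n) (v : Fin n → ℂ) (m : ℕ) :
    pderiv i (linFormDividedPow v (m + 1)) = v i • linFormDividedPow v m := by
  have h : ((m + 1).factorial : ℂ)⁻¹ * (m + 1) = (m.factorial : ℂ)⁻¹ := by
    have : (m + 1 : ℂ) ≠ 0 := by exact_mod_cast m.succ_ne_zero
    rw [Nat.factorial_succ]
    push_cast
    field_simp
  rw [linFormDividedPow, pderiv_C_mul, pderiv_pow, pderiv_linForm, linFormDividedPow, ← h,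
    smul_eq_C_mul]
  simp only [map_mul, map_add, map_natCast, map_one, Nat.cast_add, Nat.cast_one,
    Nat.add_sub_cancel]
  ring

theorem pderiv_pow_linFormDividedPow (i : Fin n) (v : Fin n → ℂ) (m k : ℕ) :
    ((pderiv (R := ℂ) i).toLinearMap ^ k : Module.End ℂ (MvPolynomial (Fin n) ℂ))
      (linFormDividedPow v (m + k)) = v i ^ k • linFormDividedPow v m := by
  induction k with
  | zero => simp
  | succ k ih =>
    have h : (pderiv (R := ℂ) i).toLinearMap (linFormDividedPow v (m + k + 1)) =
      v i • linFormDividedPow v (m + k) := pderiv_linFormDividedPow i v (m + k)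
    rw [pow_succ, Module.End.mul_apply, ← add_assoc, h, map_smul, ih, smul_smul, pow_succ']

theorem monOp_linFormDividedPow (d : Fin n →₀ ℕ) (v : Fin n → ℂ) :
    monOp d (linFormDividedPow v (∑ i, d i)) = C (∏ i, v i ^ d i) := by
  have h : ∀ (l : List (Fin n)) (m : ℕ), (l.map fun i => ((pderiv (R := ℂ) i).toLinearMap :
      Module.End ℂ (MvPolynomial (Fin n) ℂ)) ^ d i).prod
        (linFormDividedPow v (m + (l.map fun i => d i).sum)) =
      (l.map fun i => v i ^ d i).prod • linFormDividedPow v m := by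
    intro l
    induction l with
    | nil => simp
    | cons i l ih =>
      intro m
      rw [List.map_cons, List.prod_cons, Module.End.mul_apply, List.map_cons, List.sum_cons,
        ← add_assoc, ih, map_smul, pderiv_pow_linFormDividedPow, smul_smul, List.map_cons,
        List.prod_cons, mul_comm]
  have h' := h (List.finRange n) 0
  rw [← List.ofFn_eq_map, ← List.ofFn_eq_map, ← List.ofFn_eq_map, List.sum_ofFn, List.prod_ofFn,
    zero_add] at h'
  rw [monOp, h', linFormDividedPow, smul_eq_C_mul]
  simp

/-- The apolarity pairing with `k`, as a linear map. -/
noncomputable def pairingLin (k : MvPolynomial (Fin n) ℂ) : MvPolynomial (Fin n) ℂ →ₗ[ℂ] ℂ :=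
  (aeval fun _ => (0 : ℂ)).toLinearMap ∘ₗ ∑ d ∈ k.support, coeff d k • monOp d

theorem pairingLin_apply (k f : MvPolynomial (Fin n) ℂ) : pairingLin k f = pairing f k := by
  simp [pairingLin, pairing, apolar, aeval_eq_eval]

theorem pairing_linForm_pow_three {k : MvPolynomial (Fin n) ℂ} (hk : k.IsHomogeneous 3)
    (v : Fin n → ℂ) : pairing (linForm v ^ 3) k = 6 * eval v k := by
  have h3 : linForm v ^ 3 = (6 : ℂ) • linFormDividedPow v 3 := by
    rw [linFormDividedPow, smul_eq_C_mul, ← mul_assoc, ← C_mul]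
    norm_num [Nat.factorial]
  rw [h3, ← pairingLin_apply, map_smul, pairingLin_apply, smul_eq_mul, pairing, apolar, map_sum,
    eval_eq' v]
  congr 1
  refine Finset.sum_congr rfl fun d hd => ?_
  have hdeg : ∑ i, d i = 3 := by
    rw [← hk (mem_support_iff.1 hd), ← Finsupp.degree_eq_sum, Finsupp.degree_eq_weight_one]
    rfl
  rw [← hdeg, monOp_linFormDividedPow, smul_eval, eval_C]

/-- Cubic forms are spanned by products of three variables. -/
theorem homogeneousSubmodule_three_eq_span : homogeneousSubmodule (Fin n) ℂ 3 =
    Submodule.span ℂ (Set.range fun t : Fin n × Fin n × Fin n => X t.1 * X t.2.1 * X t.2.2) := by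
  rw [← homogeneousSubmodule_one_pow, homogeneousSubmodule_one_eq_span_X, pow_succ, pow_two,
    Submodule.span_mul_span, Submodule.span_mul_span]
  congr 1
  ext f
  simp [Set.mem_mul, mul_assoc]

/-- Cubic forms are spanned by cubes of linear forms. -/
theorem homogeneousSubmodule_three_le_span_cubes : homogeneousSubmodule (Fin n) ℂ 3 ≤
    Submodule.span ℂ (Set.range fun v : Fin n → ℂ => linForm v ^ 3) := by
  rw [homogeneousSubmodule_three_eq_span, Submodule.span_le]
  rintro _ ⟨⟨i, j, l⟩, rfl⟩
  have hc : ∀ v : Fin n → ℂ, linForm v ^ 3 ∈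
      Submodule.span ℂ (Set.range fun v : Fin n → ℂ => linForm v ^ 3) :=
    fun v => Submodule.subset_span ⟨v, rfl⟩
  let e : Fin n → Fin n → ℂ := fun i => Pi.single i 1
  have h : (X i * X j * X l : MvPolynomial (Fin n) ℂ) = (6 : ℂ)⁻¹ • (linForm (e i + e j + e l) ^ 3
      - linForm (e i + e j) ^ 3 - linForm (e j + e l) ^ 3 - linForm (e i + e l) ^ 3
      + linForm (e i) ^ 3 + linForm (e j) ^ 3 + linForm (e l) ^ 3) := by
    rw [eq_inv_smul_iff₀ (by norm_num), smul_eq_C_mul]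
    simp only [linForm_add, e, linForm_single, map_ofNat]
    ring
  change X i * X j * X l ∈ _
  rw [h]
  exact Submodule.smul_mem _ _ (add_mem (add_mem (add_mem (sub_mem (sub_mem (sub_mem (hc _) (hc _))
    (hc _)) (hc _)) (hc _)) (hc _)) (hc _))

theorem linForm_pow_three (v : Fin n → ℂ) :
    linForm v ^ 3 = ∑ i, ∑ j, ∑ l, (v i * v j * v l) • (X i * X j * X l) := by
  rw [pow_succ, pow_two]
  simp only [linForm, Finset.sum_mul, Finset.mul_sum, smul_eq_C_mul, map_mul]
  rw [Finset.sum_comm, Finset.sum_congr rfl fun i _ => Finset.sum_comm, Finset.sum_comm]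
  rw [Finset.sum_congr rfl fun i _ => Finset.sum_comm]
  exact Finset.sum_congr rfl fun i _ => Finset.sum_congr rfl fun j _ =>
    Finset.sum_congr rfl fun l _ => by ring

/-- A cubic form apolar to all cubics vanishing on a set is a combination of cubes of points of
that set. -/
theorem mem_span_cubes_of_pairing_eq_zero {α : Type*} (p : α → Fin n → ℂ)
    {f : MvPolynomial (Fin n) ℂ} (hf : f.IsHomogeneous 3)
    (h : ∀ k : MvPolynomial (Fin n) ℂ, k.IsHomogeneous 3 → (∀ a, eval (p a) k = 0) →
      pairing f k = 0) :
    f ∈ Submodule.span ℂ (Set.range fun a => linForm (p a) ^ 3) := by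
  by_contra hne
  obtain ⟨φ, hφf, hφ⟩ := Submodule.exists_le_ker_of_notMem hne
  let k : MvPolynomial (Fin n) ℂ := ∑ i, ∑ j, ∑ l, φ (X i * X j * X l) • (X i * X j * X l)
  have hk : k.IsHomogeneous 3 := by
    refine (mem_homogeneousSubmodule _ _).1 (Submodule.sum_mem _ fun i _ => Submodule.sum_mem _
      fun j _ => Submodule.sum_mem _ fun l _ => Submodule.smul_mem _ _ ?_)
    rw [homogeneousSubmodule_three_eq_span]
    exact Submodule.subset_span ⟨(i, j, l), rfl⟩
  have hev : ∀ v, eval v k = φ (linForm v ^ 3) := fun v => by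
    simp [k, linForm_pow_three, mul_comm]
  have hpair : Set.EqOn (pairingLin k) ⇑((6 : ℂ) • φ)
      (Set.range fun v => linForm v ^ 3) := by
    rintro _ ⟨v, rfl⟩
    simp [pairingLin_apply, pairing_linForm_pow_three hk, hev]
  have h6 := LinearMap.eqOn_span hpair
    (homogeneousSubmodule_three_le_span_cubes ((mem_homogeneousSubmodule _ _).2 hf))
  rw [pairingLin_apply, h k hk fun a => ?_] at h6
  · simp [hφf] at h6
  · rw [hev]
    exact hφ (Submodule.subset_span ⟨a, rfl⟩)

end Pairing

section Coordinates

variable (e : homogeneousSubmodule (Fin 6) ℂ 3 ≃ₗ[ℂ] (Fin 56 → ℂ))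

theorem X_mul_X_mul_X_mem (i j l : Fin 6) :
    (X i * X j * X l : MvPolynomial (Fin 6) ℂ) ∈ homogeneousSubmodule (Fin 6) ℂ 3 := by
  rw [homogeneousSubmodule_three_eq_span]
  exact Submodule.subset_span ⟨(i, j, l), rfl⟩

/-- The coordinates of the monomials of degree three. -/
noncomputable def monomialTensor (i j l : Fin 6) : Fin 56 → ℂ :=
  e ⟨X i * X j * X l, X_mul_X_mul_X_mem i j l⟩

theorem isSymTensor_monomialTensor : IsSymTensor (monomialTensor e) := fun i j l => by
  constructor <;>
  · refine congrArg e (Subtype.ext ?_)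
    ring

theorem eq_zero_of_sum_mul_monomialTensor {g : Fin 56 → ℂ}
    (h : ∀ i j l, ∑ n, g n * monomialTensor e i j l n = 0) : g = 0 := by
  let φ : homogeneousSubmodule (Fin 6) ℂ 3 →ₗ[ℂ] ℂ := Fintype.linearCombination ℂ g ∘ₗ e.toLinearMap
  have hφ : ∀ f, φ f = ∑ n, g n * e f n := fun f => by
    simp [φ, Fintype.linearCombination_apply, mul_comm]
  have hle : homogeneousSubmodule (Fin 6) ℂ 3 ≤
      (LinearMap.ker φ).map (homogeneousSubmodule (Fin 6) ℂ 3).subtype := by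
    conv_lhs => rw [homogeneousSubmodule_three_eq_span]
    rw [Submodule.span_le]
    rintro _ ⟨⟨i, j, l⟩, rfl⟩
    exact ⟨⟨_, X_mul_X_mul_X_mem i j l⟩, (hφ _).trans (h i j l), rfl⟩
  have hzero : ∀ f, φ f = 0 := fun f => by
    obtain ⟨f', hf', hff'⟩ := hle f.2
    rwa [← Subtype.ext hff']
  funext n
  have := hzero (e.symm (Pi.single n 1))
  simpa [hφ, Pi.single_apply] using this

theorem coordinates_sum_cubes {κ : Type*} [Fintype κ] (c : κ → ℂ) (a : κ → Fin 6 → ℂ)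
    {f : homogeneousSubmodule (Fin 6) ℂ 3}
    (hf : (f : MvPolynomial (Fin 6) ℂ) = ∑ r, c r • linForm (a r) ^ 3) :
    e f = secantPt (monomialTensor e) c a := by
  have h : f = ∑ r, c r • ∑ i, ∑ j, ∑ l, (a r i * a r j * a r l) •
      (⟨X i * X j * X l, X_mul_X_mul_X_mem i j l⟩ : homogeneousSubmodule (Fin 6) ℂ 3) := by
    refine Subtype.ext (hf.trans ?_)
    simp [linForm_pow_three]
  rw [h]
  simp only [map_sum, map_smul]
  funext n
  simp [secantPt, cubePt, tri, monomialTensor, mul_comm]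

theorem exists_cubicForm_eq_secantPt {κ : Type*} [Fintype κ] (c : κ → ℂ) (a : κ → Fin 6 → ℂ) :
    ∃ f : homogeneousSubmodule (Fin 6) ℂ 3,
      (f : MvPolynomial (Fin 6) ℂ) = ∑ r, c r • linForm (a r) ^ 3 ∧
      e f = secantPt (monomialTensor e) c a := by
  have hmem : ∑ r, c r • linForm (a r) ^ 3 ∈ homogeneousSubmodule (Fin 6) ℂ 3 :=
    Submodule.sum_mem _ fun r _ => Submodule.smul_mem _ _
      ((mem_homogeneousSubmodule _ _).2 (by simpa using (isHomogeneous_linForm (a r)).pow 3))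
  exact ⟨⟨_, hmem⟩, rfl, coordinates_sum_cubes e c a rfl⟩

/-- Cubic forms that are sums of ten cubes, four of which are coplanar. -/
def coplanarCubics : Set (homogeneousSubmodule (Fin 6) ℂ 3) :=
  {f | ∃ a : Fin 10 → (Fin 6 → ℂ), (f : MvPolynomial (Fin 6) ℂ) = ∑ i, linForm (a i) ^ 3 ∧
    Module.finrank ℂ (Submodule.span ℂ ({a 0, a 1, a 2, a 3} : Set (Fin 6 → ℂ))) ≤ 3}

/-- Cubic forms apolar to some Veronese surface. -/
def veroneseApolarCubics : Set (homogeneousSubmodule (Fin 6) ℂ 3) :=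
  {f | ∃ A : (Matrix (Fin 6) (Fin 6) ℂ)ˣ, ∀ k : MvPolynomial (Fin 6) ℂ, k.IsHomogeneous 3 →
    (∀ w' : Fin 3 → ℂ, eval ((A : Matrix (Fin 6) (Fin 6) ℂ).mulVec (nu w')) k = 0) →
    pairing (f : MvPolynomial (Fin 6) ℂ) k = 0}

theorem exists_coplanarPt_eq {f : homogeneousSubmodule (Fin 6) ℂ 3} (hf : f ∈ coplanarCubics) :
    ∃ B c l, coplanarPt (monomialTensor e) B c l = e f := by
  obtain ⟨a, hfa, hrank⟩ := hf
  set S : Set (Fin 6 → ℂ) := {a 0, a 1, a 2, a 3}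
  have hSfin : Module.Finite ℂ (Submodule.span ℂ S) := inferInstance
  obtain ⟨B, hB⟩ : ∃ B : Fin 3 → Fin 6 → ℂ, S ⊆ Submodule.span ℂ (Set.range B) := by
    let b := Module.finBasis ℂ (Submodule.span ℂ S)
    refine ⟨fun j => if h : (j : ℕ) < Module.finrank ℂ (Submodule.span ℂ S) then (b ⟨j, h⟩ : _)
      else 0, fun x hx => ?_⟩
    have hxr := congrArg (Submodule.subtype _) (b.sum_repr ⟨x, Submodule.subset_span hx⟩)
    rw [map_sum] at hxr
    change _ = x at hxr
    rw [← hxr]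
    refine Submodule.sum_mem _ fun j _ => ?_
    rw [map_smul]
    exact Submodule.smul_mem _ _ (Submodule.subset_span ⟨⟨j, j.2.trans_le hrank⟩, by simp⟩)
  have hmem : ∀ i : Fin 4, ∃ c : Fin 3 → ℂ, ∑ j, c j • B j = a (Fin.castAdd 6 i) := fun i =>
    (Submodule.mem_span_range_iff_exists_fun ℂ).1 (hB (by
      fin_cases i <;> simp [S]))
  choose c hc using hmem
  refine ⟨B, c, fun i => a (Fin.natAdd 4 i), ?_⟩
  refine (coordinates_sum_cubes e _ _ ?_).symm
  rw [hfa, Fintype.sum_sum_type, Fin.sum_univ_add (a := 4) (b := 6)]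
  simp [coplanarVectors, hc]

theorem coplanarPt_mem (B : Fin 3 → Fin 6 → ℂ) (c : Fin 4 → Fin 3 → ℂ) (l : Fin 6 → Fin 6 → ℂ) :
    coplanarPt (monomialTensor e) B c l ∈ e '' coplanarCubics := by
  obtain ⟨f, hf, hef⟩ := exists_cubicForm_eq_secantPt e (fun _ => 1) (coplanarVectors B c l)
  refine ⟨f, ⟨fun i => coplanarVectors B c l (finSumFinEquiv.symm i), ?_, ?_⟩, hef⟩
  · rw [hf, ← Equiv.sum_comp finSumFinEquiv.symm]
    simp
  · have hmem : ∀ i : Fin 4, coplanarVectors B c l (.inl i) ∈ Submodule.span ℂ (Set.range B) :=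
      fun i => (Submodule.mem_span_range_iff_exists_fun ℂ).2 ⟨c i, rfl⟩
    refine (Submodule.finrank_mono (t := Submodule.span ℂ (Set.range B)) ?_).trans
      (finrank_range_le_card (R := ℂ) B)
    rw [Submodule.span_le]
    rintro _ (rfl | rfl | rfl | rfl)
    exacts [hmem 0, hmem 1, hmem 2, hmem 3]

/-- The diagonal matrix relating the two normalizations of the Veronese map. -/
def veroneseScaling : Matrix (Fin 6) (Fin 6) ℂ := Matrix.diagonal ![1, 2, 2, 1, 2, 1]

theorem veroneseScaling_mulVec (w : Fin 3 → ℂ) :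
    veroneseScaling.mulVec (monVeronese w) = nu w := by
  funext i
  fin_cases i <;> simp [veroneseScaling, Matrix.mulVec_diagonal, monVeronese, nu, mul_assoc]

theorem det_veroneseScaling_ne_zero : veroneseScaling.det ≠ 0 := by
  simp [veroneseScaling, Matrix.det_diagonal, Fin.prod_univ_succ]

theorem exists_veronesePt_eq {f : homogeneousSubmodule (Fin 6) ℂ 3}
    (hf : f ∈ veroneseApolarCubics) :
    ∃ (κ : Type) (_ : Fintype κ) (c : κ → ℂ) (w : κ → Fin 3 → ℂ) (A : Matrix (Fin 6) (Fin 6) ℂ),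
      A.det ≠ 0 ∧ veronesePt (monomialTensor e) A c w = e f := by
  obtain ⟨A, hA⟩ := hf
  obtain ⟨c, hc⟩ := (Finsupp.mem_span_range_iff_exists_finsupp).1
    (mem_span_cubes_of_pairing_eq_zero _ ((mem_homogeneousSubmodule _ _).1 f.2) hA)
  refine ⟨c.support, inferInstance, fun r => c r, fun r => r, A * veroneseScaling, ?_,
    (coordinates_sum_cubes e _ _ ?_).symm⟩
  · rw [Matrix.det_mul]
    exact mul_ne_zero ((Matrix.isUnit_iff_isUnit_det _).1 A.isUnit).ne_zero
      det_veroneseScaling_ne_zero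
  · rw [← hc, Finsupp.sum, ← Finset.sum_coe_sort]
    simp only [← Matrix.mulVec_mulVec, veroneseScaling_mulVec]

theorem veronesePt_mem {κ : Type} [Fintype κ] (c : κ → ℂ) (w : κ → Fin 3 → ℂ)
    {A : Matrix (Fin 6) (Fin 6) ℂ} (hA : A.det ≠ 0) :
    veronesePt (monomialTensor e) A c w ∈ e '' veroneseApolarCubics := by
  obtain ⟨f, hf, hef⟩ := exists_cubicForm_eq_secantPt e c fun r => A.mulVec (monVeronese (w r))
  have hD : IsUnit veroneseScaling.det := det_veroneseScaling_ne_zero.isUnit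
  have hU : IsUnit (A * veroneseScaling⁻¹) := (Matrix.isUnit_iff_isUnit_det _).2 (by
    rw [Matrix.det_mul]
    exact hA.isUnit.mul (Matrix.isUnit_nonsing_inv_det _ hD))
  refine ⟨f, ⟨hU.unit, fun k hk hv => ?_⟩, hef⟩
  rw [hf, ← pairingLin_apply, map_sum]
  refine Finset.sum_eq_zero fun r _ => ?_
  have h0 := hv (w r)
  rw [← veroneseScaling_mulVec, Matrix.mulVec_mulVec, IsUnit.unit_spec, mul_assoc,
    Matrix.nonsing_inv_mul _ hD, mul_one] at h0
  rw [map_smul, pairingLin_apply, pairing_linForm_pow_three hk, h0, mul_zero, smul_zero]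

end Coordinates

theorem subset_zcl (S : Set (Fin 56 → ℂ)) : S ⊆ zcl S := fun _ hx _ hP => hP _ hx

theorem zcl_coplanarCubics_ne (e : homogeneousSubmodule (Fin 6) ℂ 3 ≃ₗ[ℂ] (Fin 56 → ℂ)) :
    zcl (e '' coplanarCubics) ≠ zcl (e '' veroneseApolarCubics) := by
  intro heq
  set s := monomialTensor e
  have hs : IsSymTensor s := isSymTensor_monomialTensor e
  obtain ⟨P₀, hP₀, hvan⟩ := exists_ne_zero_eval_coplanarPt (Fintype.card_fin 56) hs
  obtain ⟨P, hP, _, ⟨f, hf, rfl⟩, n, hn⟩ := exists_vanishing_pderiv_ne_zero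
    (S := e '' coplanarCubics) ⟨_, coplanarPt_mem e 0 0 0⟩ ⟨P₀, hP₀, by
      rintro _ ⟨f, hf, rfl⟩
      obtain ⟨B, c, l, h⟩ := exists_coplanarPt_eq e hf
      exact h ▸ hvan B c l⟩
  have hPV : ∀ y ∈ e '' veroneseApolarCubics, eval y P = 0 := fun y hy => by
    have hy' := subset_zcl _ hy
    rw [← heq] at hy'
    exact hy' P hP
  have hdefV : ∀ x y, ∀ z ∈ e '' veroneseApolarCubics, eval z (defectPoly s P x y) = 0 := by
    rintro x y _ ⟨f, hf, rfl⟩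
    obtain ⟨κ, _, c, w, A, hA, h⟩ := exists_veronesePt_eq e hf
    rw [← h, eval_defectPoly]
    exact hessianDefect_gradTensor_veronesePt hs
      (fun κ _ c w A hA => hPV _ (veronesePt_mem e c w hA)) c w hA x y
  have hdefC : ∀ B c l x y, hessianDefect (gradTensor s P (coplanarPt s B c l)) x y = 0 :=
    fun B c l x y => by
      have hy := subset_zcl _ (coplanarPt_mem e B c l)
      rw [heq] at hy
      rw [← eval_defectPoly]
      exact hy _ (hdefV x y)
  obtain ⟨B, c, l, h⟩ := exists_coplanarPt_eq e hf
  refine hn (h ▸ pderiv_eq_zero_of_gradTensor_eq_zero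
    (fun g hg => eq_zero_of_sum_mul_monomialTensor e hg)
    (gradTensor_coplanarPt_eq_zero hs (fun B c l => hP _ (coplanarPt_mem e B c l)) hdefC B c l) n)

/-- **Proposition (newprop19aout).** The divisors `D_{copl}` and `D_{V-ap}` are different:
the Zariski closures of the two corresponding sets of cubic forms do not coincide. -/
theorem statement15 :
    ∀ e : (homogeneousSubmodule (Fin 6) ℂ 3) ≃ₗ[ℂ] (Fin 56 → ℂ),
      zcl (e '' {f : homogeneousSubmodule (Fin 6) ℂ 3 |
        ∃ a : Fin 10 → (Fin 6 → ℂ),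
          (f : MvPolynomial (Fin 6) ℂ) = ∑ i, linForm (a i) ^ 3 ∧
          Module.finrank ℂ
            (Submodule.span ℂ ({a 0, a 1, a 2, a 3} : Set (Fin 6 → ℂ))) ≤ 3}) ≠
      zcl (e '' {f : homogeneousSubmodule (Fin 6) ℂ 3 |
        ∃ A : (Matrix (Fin 6) (Fin 6) ℂ)ˣ,
          ∀ k : MvPolynomial (Fin 6) ℂ, k.IsHomogeneous 3 →
            (∀ w' : Fin 3 → ℂ, eval ((A : Matrix (Fin 6) (Fin 6) ℂ).mulVec (nu w')) k = 0) →
            pairing (f : MvPolynomial (Fin 6) ℂ) k = 0}) := by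
  exact zcl_coplanarCubics_ne
end

section
/- Let T ⊂ ℂ[x₀,…,x₅] be the 20-dimensional linear span of the squarefree cubic monomials xᵢxⱼxₖ with i < j < k, and let p be the linear projection from the space of cubic forms onto T that kills every monomial divisible by the square of a variable (the projection along the degree-3 part of the Jacobian ideal of the Fermat cubic). Then T is spanned by the set of elements p((c₀x₀ + c₁x₁ + c₂x₂ + c₃x₃ + c₄x₄ + c₅x₅)³), where (b₀,…,b₅) ranges over all 6-tuples of vectors in ℂ³ such that ν(b₀), …, ν(b₅) are linearly independent in ℂ⁶, b ranges over ℂ³, and (c₀,…,c₅) is the coordinate vector of ν(b) in the basis (ν(b₀),…,ν(b₅)). (Final lemma in the proof of Proposition \ref{proDNL} of the paper: the set S of elements p(γ_{b•}((b²)³)) generates T as a vector space.) -/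
open MvPolynomial

theorem coeff_sqfreeProj (f : MvPolynomial (Fin 6) ℂ) (d : Fin 6 →₀ ℕ) :
    coeff d (sqfreeProj f) = if ∀ i, d i ≤ 1 then coeff d f else 0 := by
  classical
  simp only [sqfreeProj, coeff_sum, coeff_monomial, Finset.sum_ite_eq', Finset.mem_filter,
    mem_support_iff]
  by_cases h : coeff d f = 0 <;> simp [h]

/-- `sqfreeProj` as a linear map. -/
noncomputable def sqfreeProjLinear : MvPolynomial (Fin 6) ℂ →ₗ[ℂ] MvPolynomial (Fin 6) ℂ where
  toFun := sqfreeProj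
  map_add' f g := by
    ext d
    simp only [coeff_sqfreeProj, coeff_add]
    split_ifs <;> simp
  map_smul' a f := by
    ext d
    simp [coeff_sqfreeProj]

theorem sqfreeProjLinear_apply (f : MvPolynomial (Fin 6) ℂ) :
    sqfreeProjLinear f = sqfreeProj f := rfl

theorem sqfreeProj_X_mul_X_mul_X (i j k : Fin 6) :
    sqfreeProj (X i * X j * X k) =
      if i ≠ j ∧ i ≠ k ∧ j ≠ k then X i * X j * X k else 0 := by
  have hX : (X i * X j * X k : MvPolynomial (Fin 6) ℂ) =
      monomial (Finsupp.single i 1 + Finsupp.single j 1 + Finsupp.single k 1) 1 := by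
    simp [X, monomial_mul]
  have hsq : (∀ l, (Finsupp.single i 1 + Finsupp.single j 1 + Finsupp.single k 1 :
      Fin 6 →₀ ℕ) l ≤ 1) ↔ i ≠ j ∧ i ≠ k ∧ j ≠ k := by
    simp only [Finsupp.add_apply, Finsupp.single_apply]
    constructor
    · intro h
      refine ⟨?_, ?_, ?_⟩ <;> rintro rfl
      · have := h i; grind
      · have := h i; grind
      · have := h j; grind
    · rintro ⟨hij, hik, hjk⟩ l
      split_ifs <;> simp_all
  ext d
  rw [coeff_sqfreeProj, hX]
  simp only [← hsq]
  by_cases hd : Finsupp.single i 1 + Finsupp.single j 1 + Finsupp.single k 1 = d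
  · subst hd
    split_ifs <;> simp
  · split_ifs <;> simp [coeff_monomial, hd]

/-- The monomial `xᵢxⱼxₖ` with pairwise distinct indices is one with increasing indices. -/
theorem X_mul_X_mul_X_mem_of_ne {i j k : Fin 6} (hij : i ≠ j) (hik : i ≠ k) (hjk : j ≠ k) :
    (X i * X j * X k : MvPolynomial (Fin 6) ℂ) ∈
      {m : MvPolynomial (Fin 6) ℂ |
        ∃ i j k : Fin 6, i < j ∧ j < k ∧ m = X i * X j * X k} := by
  rcases lt_or_gt_of_ne hij with h₁ | h₁ <;> rcases lt_or_gt_of_ne hik with h₂ | h₂ <;>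
    rcases lt_or_gt_of_ne hjk with h₃ | h₃
  · exact ⟨i, j, k, h₁, h₃, rfl⟩
  · exact ⟨i, k, j, h₂, h₃, by ring⟩
  · exact absurd (h₁.trans h₃) h₂.asymm
  · exact ⟨k, i, j, h₂, h₁, by ring⟩
  · exact ⟨j, i, k, h₁, h₂, by ring⟩
  · exact absurd (h₂.trans h₃) h₁.asymm
  · exact ⟨j, k, i, h₃, h₂, by ring⟩
  · exact ⟨k, j, i, h₃, h₁, by ring⟩

/-- Six points of `ℂ³`, the first three on a line, whose squares are a basis of the
quadratic forms. -/
def squareBasis : Fin 6 → (Fin 3 → ℂ) :=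
  ![![1, 0, 0], ![0, 1, 0], ![1, -1, 0], ![0, 0, 1], ![1, 0, 1], ![0, 1, 1]]

theorem linearIndependent_nu_squareBasis :
    LinearIndependent ℂ (fun i => nu (squareBasis i)) := by
  rw [Fintype.linearIndependent_iff]
  intro g hg
  have h : ∀ l, (∑ i, g i • nu (squareBasis i)) l = 0 := fun l => by rw [hg]; rfl
  have h0 := h 0
  have h1 := h 1
  have h2 := h 2
  have h3 := h 3
  have h4 := h 4
  have h5 := h 5
  simp [Fin.sum_univ_six, nu, squareBasis] at h0 h1 h2 h3 h4 h5
  intro i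
  fin_cases i <;> simp <;> grind

theorem nu_eq_sum_squareBasis :
    nu ![1, 1, 0] = ∑ i, (![2, 2, -1, 0, 0, 0] : Fin 6 → ℂ) i • nu (squareBasis i) := by
  ext l
  fin_cases l <;> simp [Fin.sum_univ_six, nu, squareBasis] <;> norm_num

theorem exists_perm_apply_eq {i j k : Fin 6} (hij : i ≠ j) (hik : i ≠ k) (hjk : j ≠ k) :
    ∃ σ : Equiv.Perm (Fin 6), σ 0 = i ∧ σ 1 = j ∧ σ 2 = k := by
  have hinj : Function.Injective ![i, j, k] := by
    intro a b
    fin_cases a <;> fin_cases b <;> simp [hij, hik, hjk, hij.symm, hik.symm, hjk.symm]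
  obtain ⟨σ, hσ⟩ := (Equiv.Perm.isMultiplyPretransitive (Fin 6) 3).exists_smul_eq
    (Fin.castLEEmb (show 3 ≤ 6 by norm_num)) ⟨![i, j, k], hinj⟩
  exact ⟨σ, DFunLike.congr_fun hσ 0, DFunLike.congr_fun hσ 1, DFunLike.congr_fun hσ 2⟩

/-- The projection of the cube of a form supported on three variables. -/
theorem sqfreeProj_linForm_perm_cube (σ : Equiv.Perm (Fin 6)) :
    sqfreeProj (linForm ((![2, 2, -1, 0, 0, 0] : Fin 6 → ℂ) ∘ σ.symm) ^ 3) =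
      (-24 : ℂ) • (X (σ 0) * X (σ 1) * X (σ 2)) := by
  have hlin : linForm ((![2, 2, -1, 0, 0, 0] : Fin 6 → ℂ) ∘ σ.symm) =
      2 * X (σ 0) + 2 * X (σ 1) - X (σ 2) := by
    rw [linForm, ← Equiv.sum_comp σ]
    simp [Fin.sum_univ_six, sub_eq_add_neg, map_ofNat C 2]
  have hcube : ∀ x y z : MvPolynomial (Fin 6) ℂ, (2 * x + 2 * y - z) ^ 3 =
      (8 : ℂ) • (x * x * x) + (8 : ℂ) • (y * y * y) + (-1 : ℂ) • (z * z * z)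
      + (24 : ℂ) • (x * x * y) + (24 : ℂ) • (x * y * y) + (-12 : ℂ) • (x * x * z)
      + (-12 : ℂ) • (y * y * z) + (6 : ℂ) • (x * z * z) + (6 : ℂ) • (y * z * z)
      + (-24 : ℂ) • (x * y * z) := by
    intro x y z
    simp only [smul_eq_C_mul, map_neg, map_ofNat, map_one]
    ring
  rw [hlin, hcube, ← sqfreeProjLinear_apply]
  simp only [map_add, map_smul, sqfreeProjLinear_apply, sqfreeProj_X_mul_X_mul_X]
  simp

theorem sqfreeProj_linForm_cube_mem (c : Fin 6 → ℂ) :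
    sqfreeProj (linForm c ^ 3) ∈ Submodule.span ℂ
      {m : MvPolynomial (Fin 6) ℂ |
        ∃ i j k : Fin 6, i < j ∧ j < k ∧ m = X i * X j * X k} := by
  have hcube : linForm c ^ 3 =
      ∑ i, ∑ j, ∑ k, (c i * c j * c k) • (X i * X j * X k : MvPolynomial (Fin 6) ℂ) := by
    rw [pow_three', linForm, Finset.sum_mul_sum, Finset.sum_mul]
    refine Finset.sum_congr rfl fun i _ => ?_
    rw [Finset.sum_mul_sum]
    refine Finset.sum_congr rfl fun j _ => Finset.sum_congr rfl fun k _ => ?_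
    simp only [smul_eq_C_mul, map_mul]
    ring
  rw [hcube, ← sqfreeProjLinear_apply]
  simp only [map_sum, map_smul, sqfreeProjLinear_apply, sqfreeProj_X_mul_X_mul_X]
  refine Submodule.sum_mem _ fun i _ => Submodule.sum_mem _ fun j _ =>
    Submodule.sum_mem _ fun k _ => Submodule.smul_mem _ _ ?_
  split_ifs with h
  · exact Submodule.subset_span (X_mul_X_mul_X_mem_of_ne h.1 h.2.1 h.2.2)
  · exact Submodule.zero_mem _

/-- **Final lemma in the proof of Proposition (proDNL).** The 20-dimensional space `T`
spanned by the squarefree cubic monomials is spanned by the projections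
`p((c·x)³)`, where `c` is the coordinate vector of `ν(b)` in a basis `(ν(b₀),…,ν(b₅))`. -/
theorem statement19 :
    Submodule.span ℂ
      {t : MvPolynomial (Fin 6) ℂ |
        ∃ (b : Fin 6 → (Fin 3 → ℂ)) (b' : Fin 3 → ℂ) (c : Fin 6 → ℂ),
          LinearIndependent ℂ (fun i => nu (b i)) ∧
          nu b' = ∑ i, c i • nu (b i) ∧
          t = sqfreeProj (linForm c ^ 3)} =
    Submodule.span ℂ
      {m : MvPolynomial (Fin 6) ℂ |
        ∃ i j k : Fin 6, i < j ∧ j < k ∧ m = X i * X j * X k} := by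
  apply le_antisymm <;> rw [Submodule.span_le]
  · rintro _ ⟨b, b', c, -, -, rfl⟩
    exact sqfreeProj_linForm_cube_mem c
  · rintro _ ⟨i, j, k, hij, hjk, rfl⟩
    obtain ⟨σ, rfl, rfl, rfl⟩ := exists_perm_apply_eq hij.ne (hij.trans hjk).ne hjk.ne
    have hmon : (X (σ 0) * X (σ 1) * X (σ 2) : MvPolynomial (Fin 6) ℂ) = (-24 : ℂ)⁻¹ •
        sqfreeProj (linForm ((![2, 2, -1, 0, 0, 0] : Fin 6 → ℂ) ∘ σ.symm) ^ 3) := by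
      rw [sqfreeProj_linForm_perm_cube, inv_smul_smul₀ (by norm_num)]
    rw [hmon]
    refine Submodule.smul_mem _ _ (Submodule.subset_span
      ⟨squareBasis ∘ σ.symm, ![1, 1, 0], _, ?_, ?_, rfl⟩)
    · exact linearIndependent_nu_squareBasis.comp _ σ.symm.injective
    · rw [nu_eq_sum_squareBasis, ← Equiv.sum_comp σ.symm]
      rfl
end
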